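/- arXiv:2108.00458 — 3 statements merged into one kernel-verified Lean document; each statement's English description precedes it below -/
import Mathlib

section
/- Let 0 ≤ b ≤ 2 and a ≥ 0 be integers. Let S(a,b) be the complex whose term in position k, for 0 ≤ k ≤ a−1, is Δ⁻(Λ₊ᵏ∧Λ₋ᵇ ⊗ ℂ[x₁,x₂]), whose term in position a is ker(Δ⁺ : Δ⁻(Λ₊ᵃ∧Λ₋ᵇ ⊗ ℂ[x₁,x₂]) → Δ⁻(Λ₊^{a+1}∧Λ₋ᵇ ⊗ ℂ[x₁,x₂])), and whose differential maps position k to position k+1 by Δ⁺. Then for every 0 ≤ k ≤ a the homology of S(a,b) at position k (the kernel of the outgoing differential modulo the image of the incoming one; at position a the full term modulo the image) is a ℂ-vector space of dimension binom(2, k+1+b) (interpreted as 0 when k+1+b > 2). -/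
/- Setup: `Ex = ⋀(ℂ⁴)` is the exterior algebra on generators `f 0, f 1, f 2, f 3`
(`f 0, f 1` the "plus" generators, `f 2, f 3` the "minus" generators).
`lamPM k b` is the subspace `Λ₊ᵏ∧Λ₋ᵇ` spanned by products of `k` plus-generators and
`b` minus-generators.  On `Ex ⊗[ℂ] ℂ[x₁,x₂]` the operators are
`Δ⁺(ω ⊗ p) = (f₁∧ω) ⊗ ∂₁p + (f₂∧ω) ⊗ ∂₂p` and
`Δ⁻(ω ⊗ p) = (f₃∧ω) ⊗ ∂₁p + (f₄∧ω) ⊗ ∂₂p`. -/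

set_option synthInstance.maxHeartbeats 1000000
set_option maxHeartbeats 1000000

noncomputable section

open scoped TensorProduct

abbrev Ex : Type := ExteriorAlgebra ℂ (Fin 4 → ℂ)

def f (i : Fin 4) : Ex := ExteriorAlgebra.ι ℂ (Pi.single i 1)

/-- `Λ₊ᵏ∧Λ₋ᵇ`: the span of products of `k` plus-generators and `b` minus-generators. -/
def lamPM (k b : ℕ) : Submodule ℂ Ex :=
  Submodule.span ℂ {x | ∃ lp lm : List (Fin 2), lp.length = k ∧ lm.length = b ∧
    x = (lp.map (fun i : Fin 2 => f ⟨i.1, by have := i.2; omega⟩)).prod *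
        (lm.map (fun i : Fin 2 => f ⟨i.1 + 2, by have := i.2; omega⟩)).prod}

abbrev P2 : Type := MvPolynomial (Fin 2) ℂ

abbrev MEx : Type := Ex ⊗[ℂ] P2

instance : AddCommGroup MEx := inferInstance
instance : Module ℂ MEx := inferInstance

def pd (i : Fin 2) : P2 →ₗ[ℂ] P2 := (MvPolynomial.pderiv i).toLinearMap

/-- `Δ⁺(ω ⊗ p) = (f₁∧ω) ⊗ ∂₁p + (f₂∧ω) ⊗ ∂₂p` -/
def Δp : MEx →ₗ[ℂ] MEx :=
  TensorProduct.map (LinearMap.mulLeft ℂ (f 0)) (pd 0) +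
  TensorProduct.map (LinearMap.mulLeft ℂ (f 1)) (pd 1)

/-- `Δ⁻(ω ⊗ p) = (f₃∧ω) ⊗ ∂₁p + (f₄∧ω) ⊗ ∂₂p` -/
def Δm : MEx →ₗ[ℂ] MEx :=
  TensorProduct.map (LinearMap.mulLeft ℂ (f 2)) (pd 0) +
  TensorProduct.map (LinearMap.mulLeft ℂ (f 3)) (pd 1)

/-- `Λ₊ᵏ∧Λ₋ᵇ ⊗ ℂ[x₁,x₂]` inside `Ex ⊗ ℂ[x₁,x₂]`. -/
def sect (k b : ℕ) : Submodule ℂ MEx :=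
  Submodule.span ℂ {z | ∃ ω ∈ lamPM k b, ∃ p : P2, z = ω ⊗ₜ p}

/-- The numerator of the homology of `S(a,b)` at position `k`: the kernel of the
outgoing differential `Δ⁺` on the term `Δ⁻(Λ₊ᵏ∧Λ₋ᵇ ⊗ ℂ[x₁,x₂])` (at the end
position `k = a` this is exactly the whole term of `S(a,b)` there). -/
def Snum (k b : ℕ) : Submodule ℂ MEx :=
  Submodule.map Δm (sect k b) ⊓ LinearMap.ker Δp

/-- The denominator: the image of the incoming differential (`⊥` at position `0`). -/
def Sden (k b : ℕ) : Submodule ℂ MEx :=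
  if k = 0 then ⊥ else Submodule.map Δp (Submodule.map Δm (sect (k - 1) b))

set_option linter.unusedSimpArgs false

/-! ### Relations in the exterior algebra -/

lemma f_sq (i : Fin 4) : f i * f i = 0 := ExteriorAlgebra.ι_sq_zero _

lemma f_sq_l (i : Fin 4) (x : Ex) : f i * (f i * x) = 0 := by
  rw [← mul_assoc, f_sq, zero_mul]

lemma f_swap (i j : Fin 4) : f j * f i = -(f i * f j) :=
  eq_neg_of_add_eq_zero_left (ExteriorAlgebra.ι_add_mul_swap _ _)

lemma f_swap_l (i j : Fin 4) (x : Ex) : f j * (f i * x) = -(f i * (f j * x)) := by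
  rw [← mul_assoc, f_swap, neg_mul, mul_assoc]

/-- contraction with the `i`-th coordinate functional -/
def ct (i : Fin 4) : Ex →ₗ[ℂ] Ex :=
  CliffordAlgebra.contractLeft (Q := (0 : QuadraticForm ℂ (Fin 4 → ℂ))) (LinearMap.proj i)

lemma ct_mul (i j : Fin 4) (x : Ex) :
    ct i (f j * x) = (if i = j then x else 0) - f j * ct i x := by
  have := CliffordAlgebra.contractLeft_ι_mul (Q := (0 : QuadraticForm ℂ (Fin 4 → ℂ)))
    (LinearMap.proj i) (Pi.single j 1) x
  refine this.trans ?_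
  congr 1
  by_cases h : i = j
  · subst h; simp
  · simp [h]

lemma ct_one (i : Fin 4) : ct i 1 = 0 :=
  CliffordAlgebra.contractLeft_one (Q := (0 : QuadraticForm ℂ (Fin 4 → ℂ))) _

lemma ct_f (i j : Fin 4) : ct i (f j) = if i = j then 1 else 0 := by
  have := ct_mul i j 1
  simpa [ct_one] using this

def ex0 : Ex →ₗ[ℂ] ℂ := (ExteriorAlgebra.algebraMapInv (R := ℂ) (M := Fin 4 → ℂ)).toLinearMap

lemma ex0_one : ex0 1 = 1 := by simp [ex0]

/-- coefficient extraction -/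
def cf (φ : Ex →ₗ[ℂ] ℂ) : MEx →ₗ[ℂ] P2 :=
  (TensorProduct.lid ℂ P2).toLinearMap ∘ₗ TensorProduct.map φ LinearMap.id

lemma cf_tmul (φ : Ex →ₗ[ℂ] ℂ) (x : Ex) (p : P2) : cf φ (x ⊗ₜ p) = φ x • p := by
  simp [cf]

/-! ### Polynomials -/

/-- antiderivative -/
def ad (i : Fin 2) : P2 →ₗ[ℂ] P2 :=
  (MvPolynomial.basisMonomials (Fin 2) ℂ).constr ℂ
    (fun s => MvPolynomial.monomial (s + Finsupp.single i 1) ((s i + 1 : ℂ)⁻¹))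

lemma ad_monomial (i : Fin 2) (s : Fin 2 →₀ ℕ) :
    ad i (MvPolynomial.monomial s 1) =
      MvPolynomial.monomial (s + Finsupp.single i 1) ((s i + 1 : ℂ)⁻¹) := by
  have := (MvPolynomial.basisMonomials (Fin 2) ℂ).constr_basis ℂ
    (fun s => (MvPolynomial.monomial (s + Finsupp.single i 1) ((s i + 1 : ℂ)⁻¹) : P2)) s
  simpa [ad] using this

lemma ad_monomial' (i : Fin 2) (s : Fin 2 →₀ ℕ) (c : ℂ) :
    ad i (MvPolynomial.monomial s c) =
      MvPolynomial.monomial (s + Finsupp.single i 1) (c * (s i + 1 : ℂ)⁻¹) := by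
  have : (MvPolynomial.monomial s c : P2) = c • MvPolynomial.monomial s 1 := by
    simp [MvPolynomial.smul_monomial]
  rw [this, map_smul, ad_monomial, MvPolynomial.smul_monomial, smul_eq_mul]

lemma pd_ad (i : Fin 2) (p : P2) : pd i (ad i p) = p := by
  suffices h : pd i ∘ₗ ad i = LinearMap.id from LinearMap.congr_fun h p
  refine (MvPolynomial.basisMonomials (Fin 2) ℂ).ext fun s => ?_
  simp only [MvPolynomial.coe_basisMonomials, LinearMap.comp_apply, LinearMap.id_apply, pd,
    ad_monomial, Derivation.coeFn_coe, MvPolynomial.pderiv_monomial]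
  have : ((s i : ℂ) + 1) ≠ 0 := Nat.cast_add_one_ne_zero _
  rw [add_tsub_cancel_right]
  simp [this]

lemma pd_ad_ne (i j : Fin 2) (hij : i ≠ j) (p : P2) : pd i (ad j p) = ad j (pd i p) := by
  suffices h : pd i ∘ₗ ad j = ad j ∘ₗ pd i from LinearMap.congr_fun h p
  refine (MvPolynomial.basisMonomials (Fin 2) ℂ).ext fun s => ?_
  simp only [MvPolynomial.coe_basisMonomials, LinearMap.comp_apply, pd,
    ad_monomial, Derivation.coeFn_coe, MvPolynomial.pderiv_monomial, ad_monomial']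
  by_cases h0 : s i = 0
  · simp [h0, hij.symm, hij]
  have e1 : s + Finsupp.single j 1 - Finsupp.single i 1 =
      s - Finsupp.single i 1 + Finsupp.single j 1 := by
    ext t
    by_cases h1 : t = i
    · subst h1; simp [hij, hij.symm]
    · by_cases h2 : t = j
      · subst h2; simp [h1, Finsupp.single_apply, hij]
      · simp [h1, h2, Finsupp.single_apply, Ne.symm h1, Ne.symm h2]
  rw [e1]
  simp [hij.symm, hij, mul_comm]

lemma pd_comm (i j : Fin 2) (p : P2) : pd i (pd j p) = pd j (pd i p) := by
  ext m
  simp only [pd, Derivation.coeFn_coe, MvPolynomial.coeff_pderiv]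
  by_cases h : i = j
  · subst h; rfl
  · simp [add_right_comm, Finsupp.single_apply, h, Ne.symm h, mul_right_comm]

lemma pd_C (i : Fin 2) (c : ℂ) : pd i (MvPolynomial.C c) = 0 := MvPolynomial.pderiv_C

lemma const_of_pd (p : P2) (h0 : pd 0 p = 0) (h1 : pd 1 p = 0) :
    p = MvPolynomial.C (MvPolynomial.constantCoeff p) := by
  have key : ∀ i, pd i p = 0 := by intro i; fin_cases i <;> assumption
  ext m
  rw [MvPolynomial.coeff_C]
  split_ifs with h
  · subst h; rfl
  · obtain ⟨i, hi⟩ : ∃ i, m i ≠ 0 := by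
      by_contra! hc
      exact h (by ext i; simp [hc])
    have h2 := congrArg (MvPolynomial.coeff (m - Finsupp.single i 1)) (key i)
    simp only [pd, Derivation.coeFn_coe, MvPolynomial.coeff_pderiv] at h2
    rw [Finsupp.sub_add_single_one_cancel hi] at h2
    have h3 : (((m i - 1 : ℕ) : ℂ) + 1) ≠ 0 := Nat.cast_add_one_ne_zero _
    simpa [h3] using h2

lemma poincare (p q : P2) (h : pd 0 q = pd 1 p) : ∃ r, pd 0 r = p ∧ pd 1 r = q := by
  refine ⟨ad 0 p + ad 1 (q - pd 1 (ad 0 p)), ?_, ?_⟩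
  · rw [map_add, pd_ad, pd_ad_ne 0 1 (by decide), map_sub, pd_comm, pd_ad, h]; simp
  · rw [map_add, pd_ad]; simp

/-! ### Sections -/

lemma sect_le (k b : ℕ) (T : Submodule ℂ MEx)
    (h : ∀ lp lm : List (Fin 2), lp.length = k → lm.length = b → ∀ p : P2,
      ((lp.map (fun i : Fin 2 => f ⟨i.1, by have := i.2; omega⟩)).prod *
        (lm.map (fun i : Fin 2 => f ⟨i.1 + 2, by have := i.2; omega⟩)).prod) ⊗ₜ p ∈ T) :
    sect k b ≤ T := by
  refine Submodule.span_le.2 ?_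
  rintro z ⟨ω, hω, p, rfl⟩
  have : lamPM k b ≤ T.comap ((TensorProduct.mk ℂ Ex P2).flip p) := by
    refine Submodule.span_le.2 ?_
    rintro x ⟨lp, lm, h1, h2, rfl⟩
    exact h lp lm h1 h2 p
  exact this hω

lemma mem_sect (lp lm : List (Fin 2)) (p : P2) :
    ((lp.map (fun i : Fin 2 => f ⟨i.1, by have := i.2; omega⟩)).prod *
        (lm.map (fun i : Fin 2 => f ⟨i.1 + 2, by have := i.2; omega⟩)).prod) ⊗ₜ p
      ∈ sect lp.length lm.length :=
  Submodule.subset_span ⟨_, Submodule.subset_span ⟨lp, lm, rfl, rfl, rfl⟩, p, rfl⟩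

lemma Δp_tmul (x : Ex) (p : P2) :
    Δp (x ⊗ₜ p) = (f 0 * x) ⊗ₜ pd 0 p + (f 1 * x) ⊗ₜ pd 1 p := by simp [Δp]

lemma Δm_tmul (x : Ex) (p : P2) :
    Δm (x ⊗ₜ p) = (f 2 * x) ⊗ₜ pd 0 p + (f 3 * x) ⊗ₜ pd 1 p := by simp [Δm]

lemma build {M : Type} [AddCommGroup M] [Module ℂ M] (N D : Submodule ℂ M) (n : ℕ)
    (L : M →ₗ[ℂ] (Fin n → ℂ)) (h1 : ∀ z ∈ N, L z = 0 ↔ z ∈ D) (h2 : ∀ v, ∃ z ∈ N, L z = v) :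
    Nonempty ((↥N ⧸ (Submodule.comap N.subtype D)) ≃ₗ[ℂ] (Fin n → ℂ)) := by
  have hk : Submodule.comap N.subtype D = LinearMap.ker (L ∘ₗ N.subtype) := by
    ext z
    simpa using (h1 z.1 z.2).symm
  have hs : Function.Surjective (L ∘ₗ N.subtype) := by
    intro v
    obtain ⟨z, hz, rfl⟩ := h2 v
    exact ⟨⟨z, hz⟩, rfl⟩
  exact ⟨(Submodule.quotEquivOfEq _ _ hk).trans (LinearMap.quotKerEquivOfSurjective _ hs)⟩

lemma build0 {M : Type} [AddCommGroup M] [Module ℂ M] (N D : Submodule ℂ M) (n : ℕ) (hn : n = 0)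
    (h : N ≤ D) :
    Nonempty ((↥N ⧸ (Submodule.comap N.subtype D)) ≃ₗ[ℂ] (Fin n → ℂ)) := by
  subst hn
  exact build N D 0 0 (fun z hz => ⟨fun _ => h hz, fun _ => rfl⟩)
    (fun v => ⟨0, zero_mem _, Subsingleton.elim _ _⟩)

lemma sect00 (z : MEx) (h : z ∈ sect 0 0) : ∃ p : P2, z = 1 ⊗ₜ p := by
  have : sect 0 0 ≤ LinearMap.range (TensorProduct.mk ℂ Ex P2 1) := by
    refine sect_le _ _ _ ?_
    intro lp lm h1 h2 p
    rw [List.length_eq_zero_iff] at h1 h2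
    subst h1 h2
    exact ⟨p, by simp⟩
  obtain ⟨p, rfl⟩ := this h
  exact ⟨p, rfl⟩

lemma sect10 (z : MEx) (h : z ∈ sect 1 0) : ∃ p q : P2, z = f 0 ⊗ₜ p + f 1 ⊗ₜ q := by
  have : sect 1 0 ≤ LinearMap.range ((TensorProduct.mk ℂ Ex P2 (f 0)).coprod
      (TensorProduct.mk ℂ Ex P2 (f 1))) := by
    refine sect_le _ _ _ ?_
    intro lp lm h1 h2 p
    rw [List.length_eq_zero_iff] at h2
    rw [List.length_eq_one_iff] at h1
    obtain ⟨i, rfl⟩ := h1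
    subst h2
    fin_cases i
    · exact ⟨(p, 0), by simp⟩
    · exact ⟨(0, p), by simp⟩
  obtain ⟨⟨p, q⟩, rfl⟩ := this h
  exact ⟨p, q, rfl⟩

lemma sect01 (z : MEx) (h : z ∈ sect 0 1) : ∃ p q : P2, z = f 2 ⊗ₜ p + f 3 ⊗ₜ q := by
  have : sect 0 1 ≤ LinearMap.range ((TensorProduct.mk ℂ Ex P2 (f 2)).coprod
      (TensorProduct.mk ℂ Ex P2 (f 3))) := by
    refine sect_le _ _ _ ?_
    intro lp lm h1 h2 p
    rw [List.length_eq_zero_iff] at h1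
    rw [List.length_eq_one_iff] at h2
    obtain ⟨i, rfl⟩ := h2
    subst h1
    fin_cases i
    · exact ⟨(p, 0), by simp⟩
    · exact ⟨(0, p), by simp⟩
  obtain ⟨⟨p, q⟩, rfl⟩ := this h
  exact ⟨p, q, rfl⟩

lemma sect20 (z : MEx) (h : z ∈ sect 2 0) : ∃ p : P2, z = (f 0 * f 1) ⊗ₜ p := by
  have : sect 2 0 ≤ LinearMap.range (TensorProduct.mk ℂ Ex P2 (f 0 * f 1)) := by
    refine sect_le _ _ _ ?_
    intro lp lm h1 h2 p
    rw [List.length_eq_zero_iff] at h2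
    rw [List.length_eq_two] at h1
    obtain ⟨i, j, rfl⟩ := h1
    subst h2
    fin_cases i <;> fin_cases j
    · exact ⟨0, by simp [f_sq]⟩
    · exact ⟨p, by simp⟩
    · exact ⟨-p, by simp [f_swap 0 1, TensorProduct.neg_tmul, TensorProduct.tmul_neg]⟩
    · exact ⟨0, by simp [f_sq]⟩
  obtain ⟨p, rfl⟩ := this h
  exact ⟨p, rfl⟩

lemma sect11 (z : MEx) (h : z ∈ sect 1 1) : ∃ p q r s : P2,
    z = ((f 0 * f 2) ⊗ₜ p + (f 0 * f 3) ⊗ₜ q) + ((f 1 * f 2) ⊗ₜ r + (f 1 * f 3) ⊗ₜ s) := by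
  have : sect 1 1 ≤ LinearMap.range (((TensorProduct.mk ℂ Ex P2 (f 0 * f 2)).coprod
      (TensorProduct.mk ℂ Ex P2 (f 0 * f 3))).coprod
      ((TensorProduct.mk ℂ Ex P2 (f 1 * f 2)).coprod
      (TensorProduct.mk ℂ Ex P2 (f 1 * f 3)))) := by
    refine sect_le _ _ _ ?_
    intro lp lm h1 h2 p
    rw [List.length_eq_one_iff] at h1 h2
    obtain ⟨i, rfl⟩ := h1
    obtain ⟨j, rfl⟩ := h2
    fin_cases i <;> fin_cases j
    · exact ⟨((p, 0), (0, 0)), by simp⟩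
    · exact ⟨((0, p), (0, 0)), by simp⟩
    · exact ⟨((0, 0), (p, 0)), by simp⟩
    · exact ⟨((0, 0), (0, p)), by simp⟩
  obtain ⟨⟨⟨p, q⟩, ⟨r, s⟩⟩, rfl⟩ := this h
  exact ⟨p, q, r, s, rfl⟩

lemma sect21 (z : MEx) (h : z ∈ sect 2 1) : ∃ p q : P2,
    z = (f 0 * (f 1 * f 2)) ⊗ₜ p + (f 0 * (f 1 * f 3)) ⊗ₜ q := by
  have : sect 2 1 ≤ LinearMap.range ((TensorProduct.mk ℂ Ex P2 (f 0 * (f 1 * f 2))).coprod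
      (TensorProduct.mk ℂ Ex P2 (f 0 * (f 1 * f 3)))) := by
    refine sect_le _ _ _ ?_
    intro lp lm h1 h2 p
    rw [List.length_eq_one_iff] at h2
    rw [List.length_eq_two] at h1
    obtain ⟨i, j, rfl⟩ := h1
    obtain ⟨l, rfl⟩ := h2
    fin_cases i <;> fin_cases j <;> fin_cases l
    · exact ⟨0, by simp [f_sq]⟩
    · exact ⟨0, by simp [f_sq]⟩
    · exact ⟨(p, 0), by simp [mul_assoc]⟩
    · exact ⟨(0, p), by simp [mul_assoc]⟩
    · exact ⟨(-p, 0), by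
        simp [f_swap 0 1, mul_assoc, TensorProduct.neg_tmul, TensorProduct.tmul_neg]⟩
    · exact ⟨(0, -p), by
        simp [f_swap 0 1, mul_assoc, TensorProduct.neg_tmul, TensorProduct.tmul_neg]⟩
    · exact ⟨0, by simp [f_sq]⟩
    · exact ⟨0, by simp [f_sq]⟩
  obtain ⟨⟨p, q⟩, rfl⟩ := this h
  exact ⟨p, q, rfl⟩

lemma sect_big (k b : ℕ) : sect (k + 3) b = ⊥ := by
  rw [eq_bot_iff]
  refine sect_le _ _ _ ?_
  intro lp lm h1 h2 p
  match lp, h1 with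
  | i :: j :: l :: t, _ =>
    fin_cases i <;> fin_cases j <;> fin_cases l <;>
      simp [mul_assoc, f_sq_l, f_swap_l 0 1]

lemma map_Δm_two (k : ℕ) : Submodule.map Δm (sect k 2) = ⊥ := by
  rw [eq_bot_iff, Submodule.map_le_iff_le_comap]
  refine sect_le _ _ _ ?_
  intro lp lm h1 h2 p
  clear h1
  rw [List.length_eq_two] at h2
  obtain ⟨i, j, rfl⟩ := h2
  have key : ∀ c : Fin 4, c = 2 ∨ c = 3 →
      f c * ((lp.map (fun i : Fin 2 => f ⟨i.1, by have := i.2; omega⟩)).prod *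
        (([i, j] : List (Fin 2)).map (fun i : Fin 2 => f ⟨i.1 + 2, by have := i.2; omega⟩)).prod)
        = 0 := by
    intro c hc
    induction lp with
    | nil =>
      rcases hc with rfl | rfl <;> fin_cases i <;> fin_cases j <;>
        simp [f_sq, f_sq_l, f_swap 2 3, f_swap_l 2 3]
    | cons a t ih =>
      rw [List.map_cons, List.prod_cons, mul_assoc, f_swap_l, ih, mul_zero, neg_zero]
  rw [Submodule.mem_comap, Δm_tmul, key 2 (by simp), key 3 (by simp)]
  simp

/-- constant term of a coefficient -/
def cc (φ : Ex →ₗ[ℂ] ℂ) : MEx →ₗ[ℂ] ℂ := MvPolynomial.lcoeff ℂ 0 ∘ₗ cf φ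

lemma cc_tmul (φ : Ex →ₗ[ℂ] ℂ) (x : Ex) (p : P2) :
    cc φ (x ⊗ₜ p) = φ x * MvPolynomial.constantCoeff p := by
  simp [cc, cf_tmul, MvPolynomial.constantCoeff_eq]

lemma mem00 (p : P2) : (1 : Ex) ⊗ₜ p ∈ sect 0 0 := by simpa using mem_sect [] [] p
lemma mem10 (p q : P2) : f 0 ⊗ₜ p + f 1 ⊗ₜ q ∈ sect 1 0 :=
  add_mem (by simpa using mem_sect [0] [] p) (by simpa using mem_sect [1] [] q)
lemma mem01 (p q : P2) : f 2 ⊗ₜ p + f 3 ⊗ₜ q ∈ sect 0 1 :=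
  add_mem (by simpa using mem_sect [] [0] p) (by simpa using mem_sect [] [1] q)
lemma mem11 (p q : P2) : (f 0 * f 3) ⊗ₜ p + (f 1 * f 3) ⊗ₜ q ∈ sect 1 1 :=
  add_mem (by simpa using mem_sect [0] [1] p) (by simpa using mem_sect [1] [1] q)


lemma Δm01 (p q : P2) : Δm (f 2 ⊗ₜ p + f 3 ⊗ₜ q) = (f 2 * f 3) ⊗ₜ (pd 0 q - pd 1 p) := by
  simp only [Δp_tmul, Δm_tmul, f_sq, f_sq_l, f_swap 0 1, f_swap_l 0 1, f_swap 0 2, f_swap_l 0 2, f_swap 0 3, f_swap_l 0 3, f_swap 1 2, f_swap_l 1 2, f_swap 1 3, f_swap_l 1 3, f_swap 2 3, f_swap_l 2 3,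
    TensorProduct.neg_tmul, TensorProduct.tmul_neg, TensorProduct.tmul_add, TensorProduct.tmul_sub,
    map_add, map_neg, map_sub, mul_neg, mul_zero, neg_neg, neg_zero, map_zero, mul_assoc, mul_one,
    TensorProduct.zero_tmul, TensorProduct.tmul_zero, add_zero, zero_add]
  abel

lemma Δm10 (p q : P2) : Δm (f 0 ⊗ₜ p + f 1 ⊗ₜ q) =
    -((f 0 * f 2) ⊗ₜ pd 0 p + (f 0 * f 3) ⊗ₜ pd 1 p + (f 1 * f 2) ⊗ₜ pd 0 q
      + (f 1 * f 3) ⊗ₜ pd 1 q) := by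
  simp only [Δp_tmul, Δm_tmul, f_sq, f_sq_l, f_swap 0 1, f_swap_l 0 1, f_swap 0 2, f_swap_l 0 2, f_swap 0 3, f_swap_l 0 3, f_swap 1 2, f_swap_l 1 2, f_swap 1 3, f_swap_l 1 3, f_swap 2 3, f_swap_l 2 3,
    TensorProduct.neg_tmul, TensorProduct.tmul_neg, TensorProduct.tmul_add, TensorProduct.tmul_sub,
    map_add, map_neg, map_sub, mul_neg, mul_zero, neg_neg, neg_zero, map_zero, mul_assoc, mul_one,
    TensorProduct.zero_tmul, TensorProduct.tmul_zero, add_zero, zero_add]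
  abel

lemma case00 : Nonempty ((↥(Snum 0 0) ⧸ (Submodule.comap (Snum 0 0).subtype (Sden 0 0))) ≃ₗ[ℂ]
      (Fin 2 → ℂ)) := by
  refine build _ _ 2 (LinearMap.pi ![cc (ex0 ∘ₗ ct 2), cc (ex0 ∘ₗ ct 3)]) ?_ ?_
  · rintro z ⟨⟨y, hy, rfl⟩, hz⟩
    obtain ⟨p, rfl⟩ := sect00 y hy
    rw [SetLike.mem_coe, LinearMap.mem_ker] at hz
    simp only [Δp_tmul, Δm_tmul, f_sq, f_sq_l, f_swap 0 1, f_swap_l 0 1, f_swap 0 2, f_swap_l 0 2, f_swap 0 3, f_swap_l 0 3, f_swap 1 2, f_swap_l 1 2, f_swap 1 3, f_swap_l 1 3, f_swap 2 3, f_swap_l 2 3,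
    TensorProduct.neg_tmul, TensorProduct.tmul_neg, TensorProduct.tmul_add, TensorProduct.tmul_sub,
    map_add, map_neg, map_sub, mul_neg, mul_zero, neg_neg, neg_zero, map_zero, mul_assoc, mul_one,
    TensorProduct.zero_tmul, TensorProduct.tmul_zero, add_zero, zero_add] at hz
    have a1 := congrArg (cf (ex0 ∘ₗ ct 2 ∘ₗ ct 0)) hz
    have a2 := congrArg (cf (ex0 ∘ₗ ct 3 ∘ₗ ct 0)) hz
    have a3 := congrArg (cf (ex0 ∘ₗ ct 2 ∘ₗ ct 1)) hz
    have a4 := congrArg (cf (ex0 ∘ₗ ct 3 ∘ₗ ct 1)) hz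
    simp [cf_tmul, cc_tmul, ct_mul, ct_f, ct_one, ex0_one] at a1 a2 a3 a4
    have b1 := const_of_pd _ a1 a3
    have b2 := const_of_pd _ a2 a4
    simp only [Sden, if_true, Submodule.mem_bot]
    rw [Δm_tmul, mul_one, mul_one, b1, b2]
    constructor
    · intro h
      have c1 := congrFun h 0
      have c2 := congrFun h 1
      simp [cf_tmul, cc_tmul, ct_mul, ct_f, ct_one, ex0_one] at c1 c2
      simp [c1, c2]
    · intro h
      rw [h, map_zero]
  · intro v
    refine ⟨(f 2) ⊗ₜ MvPolynomial.C (v 0) + (f 3) ⊗ₜ MvPolynomial.C (v 1), ⟨?_, ?_⟩, ?_⟩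
    · refine ⟨_, mem00 (ad 0 (MvPolynomial.C (v 0)) + ad 1 (MvPolynomial.C (v 1))), ?_⟩
      simp only [Δm_tmul, map_add, pd_ad, pd_ad_ne 0 1 (by decide), pd_ad_ne 1 0 (by decide),
        pd_C, map_zero, mul_one, add_zero, zero_add]
    · simp [Δp_tmul, pd_C]
    · ext i
      fin_cases i <;> simp [cf_tmul, cc_tmul, ct_mul, ct_f, ct_one, ex0_one]

lemma case01 : Nonempty ((↥(Snum 0 1) ⧸ (Submodule.comap (Snum 0 1).subtype (Sden 0 1))) ≃ₗ[ℂ]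
      (Fin 1 → ℂ)) := by
  refine build _ _ 1 (LinearMap.pi ![cc (ex0 ∘ₗ ct 3 ∘ₗ ct 2)]) ?_ ?_
  · rintro z ⟨⟨y, hy, rfl⟩, hz⟩
    obtain ⟨p, q, rfl⟩ := sect01 y hy
    rw [SetLike.mem_coe, LinearMap.mem_ker, Δm01] at hz
    rw [Δm01]
    generalize pd 0 q - pd 1 p = w at hz ⊢
    rw [Δp_tmul] at hz
    have a1 := congrArg (cf (ex0 ∘ₗ ct 3 ∘ₗ ct 2 ∘ₗ ct 0)) hz
    have a2 := congrArg (cf (ex0 ∘ₗ ct 3 ∘ₗ ct 2 ∘ₗ ct 1)) hz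
    simp [cf_tmul, cc_tmul, ct_mul, ct_f, ct_one, ex0_one] at a1 a2
    have b1 := const_of_pd _ a1 a2
    simp only [Sden, if_true, Submodule.mem_bot]
    rw [b1]
    constructor
    · intro h
      have c1 := congrFun h 0
      simp [cf_tmul, cc_tmul, ct_mul, ct_f, ct_one, ex0_one] at c1
      simp [c1]
    · intro h
      rw [h, map_zero]
  · intro v
    refine ⟨(f 2 * f 3) ⊗ₜ MvPolynomial.C (v 0), ⟨?_, ?_⟩, ?_⟩
    · refine ⟨_, mem01 0 (ad 0 (MvPolynomial.C (v 0))), ?_⟩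
      rw [Δm01, pd_ad]
      simp
    · simp [Δp_tmul, pd_C]
    · ext i
      fin_cases i
      simp [cf_tmul, cc_tmul, ct_mul, ct_f, ct_one, ex0_one]

lemma case10 : Nonempty ((↥(Snum 1 0) ⧸ (Submodule.comap (Snum 1 0).subtype (Sden 1 0))) ≃ₗ[ℂ]
      (Fin 1 → ℂ)) := by
  refine build _ _ 1 (LinearMap.pi ![cc (ex0 ∘ₗ ct 2 ∘ₗ ct 1) - cc (ex0 ∘ₗ ct 3 ∘ₗ ct 0)]) ?_ ?_
  · rintro z ⟨⟨y, hy, rfl⟩, hz⟩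
    obtain ⟨p, q, rfl⟩ := sect10 y hy
    rw [SetLike.mem_coe, LinearMap.mem_ker, Δm10] at hz
    simp only [Δp_tmul, Δm_tmul, f_sq, f_sq_l, f_swap 0 1, f_swap_l 0 1, f_swap 0 2, f_swap_l 0 2, f_swap 0 3, f_swap_l 0 3, f_swap 1 2, f_swap_l 1 2, f_swap 1 3, f_swap_l 1 3, f_swap 2 3, f_swap_l 2 3,
    TensorProduct.neg_tmul, TensorProduct.tmul_neg, TensorProduct.tmul_add, TensorProduct.tmul_sub,
    map_add, map_neg, map_sub, mul_neg, mul_zero, neg_neg, neg_zero, map_zero, mul_assoc, mul_one,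
    TensorProduct.zero_tmul, TensorProduct.tmul_zero, add_zero, zero_add] at hz
    have a1 := congrArg (cf (ex0 ∘ₗ ct 2 ∘ₗ ct 1 ∘ₗ ct 0)) hz
    have a2 := congrArg (cf (ex0 ∘ₗ ct 3 ∘ₗ ct 1 ∘ₗ ct 0)) hz
    simp [cf_tmul, cc_tmul, ct_mul, ct_f, ct_one, ex0_one] at a1 a2
    have d1 : pd 0 (pd 0 q - pd 1 p) = 0 := by
      rw [map_sub, pd_comm 0 1]
      linear_combination -a1
    have d2 : pd 1 (pd 0 q - pd 1 p) = 0 := by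
      rw [map_sub, pd_comm 1 0]
      linear_combination -a2
    have b1 := const_of_pd _ d1 d2
    simp only [Sden, one_ne_zero, if_false]
    constructor
    · intro h
      rw [Δm10] at h
      have c1 := congrFun h 0
      simp [cf_tmul, cc_tmul, ct_mul, ct_f, ct_one, ex0_one] at c1
      have c2 : MvPolynomial.constantCoeff (pd 0 q - pd 1 p) = 0 := by
        rw [map_sub]; linear_combination -c1
      rw [c2, map_zero] at b1
      obtain ⟨r, rfl, rfl⟩ := poincare p q (sub_eq_zero.1 b1)
      refine ⟨_, ⟨_, mem00 (-r), rfl⟩, ?_⟩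
      rw [Δm10]
      simp only [Δp_tmul, Δm_tmul, f_sq, f_sq_l, f_swap 0 1, f_swap_l 0 1, f_swap 0 2, f_swap_l 0 2, f_swap 0 3, f_swap_l 0 3, f_swap 1 2, f_swap_l 1 2, f_swap 1 3, f_swap_l 1 3, f_swap 2 3, f_swap_l 2 3,
    TensorProduct.neg_tmul, TensorProduct.tmul_neg, TensorProduct.tmul_add, TensorProduct.tmul_sub,
    map_add, map_neg, map_sub, mul_neg, mul_zero, neg_neg, neg_zero, map_zero, mul_assoc, mul_one,
    TensorProduct.zero_tmul, TensorProduct.tmul_zero, add_zero, zero_add, pd_comm 1 0]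
      abel
    · rintro ⟨_, ⟨y, hy, rfl⟩, h⟩
      obtain ⟨r, rfl⟩ := sect00 y hy
      rw [← h]
      ext i
      fin_cases i
      simp [Δp_tmul, Δm_tmul, cf_tmul, cc_tmul, ct_mul, ct_f, ct_one, ex0_one, pd_comm 1 0]
  · intro v
    refine ⟨(f 1 * f 2) ⊗ₜ MvPolynomial.C (v 0), ⟨?_, ?_⟩, ?_⟩
    · refine ⟨_, mem10 0 (-ad 0 (MvPolynomial.C (v 0))), ?_⟩
      rw [Δm10, map_neg, map_neg, pd_ad, pd_ad_ne 1 0 (by decide), pd_C]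
      simp [TensorProduct.tmul_neg]
    · simp [Δp_tmul, pd_C]
    · ext i
      fin_cases i
      simp [cf_tmul, cc_tmul, ct_mul, ct_f, ct_one, ex0_one]

lemma case20 : Snum 2 0 ≤ Sden 2 0 := by
  rintro z ⟨⟨y, hy, rfl⟩, -⟩
  obtain ⟨p, rfl⟩ := sect20 y hy
  simp only [Sden, OfNat.ofNat_ne_zero, if_false]
  refine ⟨_, ⟨_, mem10 0 (-ad 0 p), rfl⟩, ?_⟩
  simp only [Δp_tmul, Δm_tmul, f_sq, f_sq_l, f_swap 0 1, f_swap_l 0 1, f_swap 0 2, f_swap_l 0 2, f_swap 0 3, f_swap_l 0 3, f_swap 1 2, f_swap_l 1 2, f_swap 1 3, f_swap_l 1 3, f_swap 2 3, f_swap_l 2 3,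
    TensorProduct.neg_tmul, TensorProduct.tmul_neg, TensorProduct.tmul_add, TensorProduct.tmul_sub,
    map_add, map_neg, map_sub, mul_neg, mul_zero, neg_neg, neg_zero, map_zero, mul_assoc, mul_one,
    TensorProduct.zero_tmul, TensorProduct.tmul_zero, add_zero, zero_add, pd_comm 0 1, pd_ad]
  abel

lemma case11 : Snum 1 1 ≤ Sden 1 1 := by
  rintro z ⟨⟨y, hy, rfl⟩, hz⟩
  obtain ⟨p, q, r, s, rfl⟩ := sect11 y hy
  have e : ∃ u v, Δm (((f 0 * f 2) ⊗ₜ p + (f 0 * f 3) ⊗ₜ q) +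
      ((f 1 * f 2) ⊗ₜ r + (f 1 * f 3) ⊗ₜ s)) =
      (f 0 * (f 2 * f 3)) ⊗ₜ u + (f 1 * (f 2 * f 3)) ⊗ₜ v := by
    refine ⟨pd 1 p - pd 0 q, pd 1 r - pd 0 s, ?_⟩
    simp only [Δp_tmul, Δm_tmul, f_sq, f_sq_l, f_swap 0 1, f_swap_l 0 1, f_swap 0 2, f_swap_l 0 2, f_swap 0 3, f_swap_l 0 3, f_swap 1 2, f_swap_l 1 2, f_swap 1 3, f_swap_l 1 3, f_swap 2 3, f_swap_l 2 3,
    TensorProduct.neg_tmul, TensorProduct.tmul_neg, TensorProduct.tmul_add, TensorProduct.tmul_sub,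
    map_add, map_neg, map_sub, mul_neg, mul_zero, neg_neg, neg_zero, map_zero, mul_assoc, mul_one,
    TensorProduct.zero_tmul, TensorProduct.tmul_zero, add_zero, zero_add]
    abel
  obtain ⟨u, v, e⟩ := e
  rw [SetLike.mem_coe, LinearMap.mem_ker, e] at hz
  rw [e]
  simp only [Δp_tmul, Δm_tmul, f_sq, f_sq_l, f_swap 0 1, f_swap_l 0 1, f_swap 0 2, f_swap_l 0 2, f_swap 0 3, f_swap_l 0 3, f_swap 1 2, f_swap_l 1 2, f_swap 1 3, f_swap_l 1 3, f_swap 2 3, f_swap_l 2 3,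
    TensorProduct.neg_tmul, TensorProduct.tmul_neg, TensorProduct.tmul_add, TensorProduct.tmul_sub,
    map_add, map_neg, map_sub, mul_neg, mul_zero, neg_neg, neg_zero, map_zero, mul_assoc, mul_one,
    TensorProduct.zero_tmul, TensorProduct.tmul_zero, add_zero, zero_add] at hz
  have a1 := congrArg (cf (ex0 ∘ₗ ct 3 ∘ₗ ct 2 ∘ₗ ct 1 ∘ₗ ct 0)) hz
  simp [cf_tmul, cc_tmul, ct_mul, ct_f, ct_one, ex0_one] at a1
  obtain ⟨w, rfl, rfl⟩ := poincare u v (by linear_combination a1)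
  simp only [Sden, one_ne_zero, if_false]
  refine ⟨_, ⟨_, mem01 0 (ad 0 w), rfl⟩, ?_⟩
  rw [Δm01, pd_ad, map_zero, sub_zero, Δp_tmul]

lemma case21 : Snum 2 1 ≤ Sden 2 1 := by
  rintro z ⟨⟨y, hy, rfl⟩, -⟩
  obtain ⟨p, q, rfl⟩ := sect21 y hy
  have e : ∃ u, Δm ((f 0 * (f 1 * f 2)) ⊗ₜ p + (f 0 * (f 1 * f 3)) ⊗ₜ q) =
      (f 0 * (f 1 * (f 2 * f 3))) ⊗ₜ u := by
    refine ⟨pd 0 q - pd 1 p, ?_⟩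
    simp only [Δp_tmul, Δm_tmul, f_sq, f_sq_l, f_swap 0 1, f_swap_l 0 1, f_swap 0 2, f_swap_l 0 2, f_swap 0 3, f_swap_l 0 3, f_swap 1 2, f_swap_l 1 2, f_swap 1 3, f_swap_l 1 3, f_swap 2 3, f_swap_l 2 3,
    TensorProduct.neg_tmul, TensorProduct.tmul_neg, TensorProduct.tmul_add, TensorProduct.tmul_sub,
    map_add, map_neg, map_sub, mul_neg, mul_zero, neg_neg, neg_zero, map_zero, mul_assoc, mul_one,
    TensorProduct.zero_tmul, TensorProduct.tmul_zero, add_zero, zero_add]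
    abel
  obtain ⟨u, e⟩ := e
  rw [e]
  simp only [Sden, OfNat.ofNat_ne_zero, if_false]
  refine ⟨_, ⟨_, mem11 0 (-ad 0 (ad 0 u)), rfl⟩, ?_⟩
  simp only [Δp_tmul, Δm_tmul, f_sq, f_sq_l, f_swap 0 1, f_swap_l 0 1, f_swap 0 2, f_swap_l 0 2, f_swap 0 3, f_swap_l 0 3, f_swap 1 2, f_swap_l 1 2, f_swap 1 3, f_swap_l 1 3, f_swap 2 3, f_swap_l 2 3,
    TensorProduct.neg_tmul, TensorProduct.tmul_neg, TensorProduct.tmul_add, TensorProduct.tmul_sub,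
    map_add, map_neg, map_sub, mul_neg, mul_zero, neg_neg, neg_zero, map_zero, mul_assoc, mul_one,
    TensorProduct.zero_tmul, TensorProduct.tmul_zero, add_zero, zero_add, pd_ad]

/-- for `0 ≤ b ≤ 2`, `0 ≤ k ≤ a`, the homology of the complex `S(a,b)`
at position `k` is a `ℂ`-vector space of dimension `binom(2, k+1+b)` (interpreted
as `0` when `k+1+b > 2`). -/
theorem homology_S (a b : ℕ) (hb : b ≤ 2) (k : ℕ) (hk : k ≤ a) :
    Nonempty ((↥(Snum k b) ⧸ (Submodule.comap (Snum k b).subtype (Sden k b))) ≃ₗ[ℂ]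
      (Fin (Nat.choose 2 (k + 1 + b)) → ℂ)) := by
  clear hk a
  rcases Nat.lt_or_ge k 3 with hk | hk
  · interval_cases b <;> interval_cases k
    · exact case00
    · exact case10
    · exact build0 _ _ _ rfl case20
    · exact case01
    · exact build0 _ _ _ rfl case11
    · exact build0 _ _ _ rfl case21
    all_goals
      refine build0 _ _ _ (Nat.choose_eq_zero_of_lt (by omega)) ?_
      rw [Snum, map_Δm_two]
      simp
  · obtain ⟨k, rfl⟩ := Nat.exists_eq_add_of_le' hk
    refine build0 _ _ _ (Nat.choose_eq_zero_of_lt (by omega)) ?_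
    rw [Snum, sect_big]
    simp

end
end

section
/- For all integers a ≥ 1 and b ≥ 1 with (a,b) ≠ (1,1), ker(∇ : M_C^{(a,b)} → M_C^{(a+1,b+1)}) = ∇(M_C^{(a−1,b−1)}); that is, the complexes of finite Verma modules of quadrant C over 𝒜(K′₄) are exact at every interior point except M(1,1,3,0). -/
/- Setup: `Cl` is the Clifford algebra over `ℂ[Θ]` realizing `U(𝔤₍<₀₎)` for
`𝒜(K′₄)`, with `w11, w22, w12, w21` as in the paper.  On `Cl ⊗[ℂ] ℂ[u₁,u₂,v₁,v₂]`
(variables `X 0, X 1 = u₁, u₂` and `X 2, X 3 = v₁, v₂`) we define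
`∇(c ⊗ q) = c·w₁₁ ⊗ u₁v₁q + c·w₂₁ ⊗ u₂v₁q + c·w₁₂ ⊗ u₁v₂q + c·w₂₂ ⊗ u₂v₂q`,
and `MC a b = Cl ⊗ (bihomogeneous polynomials of degree a in u and b in v)` is the
finite Verma module `M(a,b,(a+b)/2+2,(b−a)/2)` of quadrant C. -/

set_option synthInstance.maxHeartbeats 1000000
set_option maxHeartbeats 1000000

noncomputable section

open scoped TensorProduct

def Qf : QuadraticForm (Polynomial ℂ) (Fin 4 → Polynomial ℂ) :=
  QuadraticMap.weightedSumSquares (Polynomial ℂ) (fun _ : Fin 4 => (Polynomial.X : Polynomial ℂ))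

abbrev Cl : Type := CliffordAlgebra Qf

def η (i : Fin 4) : Cl := CliffordAlgebra.ι Qf (Pi.single i 1)

def ii : Cl := algebraMap ℂ Cl Complex.I

def w11 : Cl := η 1 + ii * η 0
def w22 : Cl := η 1 - ii * η 0
def w12 : Cl := -(η 3) + ii * η 2
def w21 : Cl := η 3 + ii * η 2

abbrev P4 : Type := MvPolynomial (Fin 4) ℂ

abbrev MCl : Type := Cl ⊗[ℂ] P4

instance : AddCommGroup MCl := inferInstance
instance : Module ℂ MCl := inferInstance

/-- `∇(c ⊗ q) = c·w₁₁ ⊗ u₁v₁q + c·w₂₁ ⊗ u₂v₁q + c·w₁₂ ⊗ u₁v₂q + c·w₂₂ ⊗ u₂v₂q` -/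
def nablaC : MCl →ₗ[ℂ] MCl :=
  TensorProduct.map (LinearMap.mulRight ℂ w11) (LinearMap.mulLeft ℂ (MvPolynomial.X 0 * MvPolynomial.X 2 : P4)) +
  TensorProduct.map (LinearMap.mulRight ℂ w21) (LinearMap.mulLeft ℂ (MvPolynomial.X 1 * MvPolynomial.X 2 : P4)) +
  TensorProduct.map (LinearMap.mulRight ℂ w12) (LinearMap.mulLeft ℂ (MvPolynomial.X 0 * MvPolynomial.X 3 : P4)) +
  TensorProduct.map (LinearMap.mulRight ℂ w22) (LinearMap.mulLeft ℂ (MvPolynomial.X 1 * MvPolynomial.X 3 : P4))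

/-- weight of the `u`-variables -/
def wu : Fin 4 → ℕ := ![1, 1, 0, 0]
/-- weight of the `v`-variables -/
def wv : Fin 4 → ℕ := ![0, 0, 1, 1]

/-- The Verma module `M_C^{(a,b)}`: the span of the `c ⊗ q` with `q` bihomogeneous of
degree `a` in `u₁,u₂` and degree `b` in `v₁,v₂`. -/
def MC (a b : ℕ) : Submodule ℂ MCl :=
  Submodule.span ℂ {z | ∃ (c : Cl) (q : P4),
    MvPolynomial.IsWeightedHomogeneous wu q a ∧ MvPolynomial.IsWeightedHomogeneous wv q b ∧
    z = c ⊗ₜ q}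


/-- the two-term operator `S p + q` -/
def shOp {A : Type*} [AddCommGroup A] (p q : A →+ A) : (ℤ → A) →+ (ℤ → A) where
  toFun x := fun j => p (x (j-1)) + q (x j)
  map_zero' := by funext j; simp
  map_add' x y := by funext j; simp; abel

@[simp] theorem shOp_apply {A : Type*} [AddCommGroup A] (p q : A →+ A) (x : ℤ → A) (j : ℤ) :
    shOp p q x j = p (x (j-1)) + q (x j) := rfl

/-- sequences supported in `[0,n]` with values in `B` -/
def seqN {A : Type*} [AddCommGroup A] (B : AddSubgroup A) (n : ℤ) : AddSubgroup (ℤ → A) where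
  carrier := {x | ∀ j, x j ∈ B ∧ ((j < 0 ∨ n < j) → x j = 0)}
  zero_mem' := fun j => ⟨B.zero_mem, fun _ => rfl⟩
  add_mem' := fun {x y} hx hy j => ⟨B.add_mem (hx j).1 (hy j).1, fun h => by
    simp [(hx j).2 h, (hy j).2 h]⟩
  neg_mem' := fun {x} hx j => ⟨B.neg_mem (hx j).1, fun h => by simp [(hx j).2 h]⟩

theorem mem_seqN {A : Type*} [AddCommGroup A] {B : AddSubgroup A} {n : ℤ} {x : ℤ → A} :
    x ∈ seqN B n ↔ ∀ j, x j ∈ B ∧ ((j < 0 ∨ n < j) → x j = 0) := Iff.rfl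

theorem shOp_mem {A : Type*} [AddCommGroup A] {B B' : AddSubgroup A} {p q : A →+ A}
    (hp : ∀ x ∈ B, p x ∈ B') (hq : ∀ x ∈ B, q x ∈ B') {n m : ℤ} (hm : m = n + 1) {x : ℤ → A}
    (hx : x ∈ seqN B n) : shOp p q x ∈ seqN B' m := by
  intro j
  refine ⟨B'.add_mem (hp _ (hx _).1) (hq _ (hx _).1), fun h => ?_⟩
  rw [shOp_apply, (hx (j-1)).2 (by omega), (hx j).2 (by omega)]
  simp

theorem ladder_aux {A : Type*} [AddCommGroup A] (B0 B1 : AddSubgroup A) (p q : A →+ A)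
    (hp : ∀ x ∈ B1, p x ∈ B0)
    (hpq : ∀ x, p (q x) + q (p x) = 0) (hpp : ∀ x, p (p x) = 0)
    (ex : ∀ x ∈ B0, q x = 0 → ∃ y ∈ B1, q y = x)
    (x : ℤ → A) (hx : ∀ j, x j ∈ B0) (hx0 : ∀ j < 0, x j = 0)
    (h : ∀ j, p (x (j-1)) + q (x j) = 0) (n : ℕ) :
    ∃ y ∈ seqN B1 n, ∀ j : ℤ, j ≤ n → x j = p (y (j-1)) + q (y j) := by
  induction n with
  | zero =>
    obtain ⟨y, hy, hyx⟩ := ex (x 0) (hx 0) (by simpa [hx0 (-1) (by norm_num)] using h 0)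
    refine ⟨fun j => if j = 0 then y else 0, fun j => ?_, fun j hj => ?_⟩
    · dsimp only
      split_ifs with hj
      · exact ⟨hy, fun h => by simp at h; omega⟩
      · exact ⟨B1.zero_mem, fun _ => rfl⟩
    · rcases eq_or_ne j 0 with rfl | hj0
      · simp [hyx]
      · have : j < 0 := by simp at hj; omega
        have h1 : j - 1 ≠ 0 := by omega
        simp [hx0 j this, hj0, h1]
  | succ n ih =>
    obtain ⟨y, hy, hyx⟩ := ih
    have key : q (x (n+1) - p (y n)) = 0 := by
      have h1 := h (n+1)
      rw [add_sub_cancel_right, hyx n le_rfl, map_add, hpp] at h1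
      have h2 := hpq (y n)
      rw [map_sub]
      rw [zero_add, add_comm] at h1
      rw [eq_neg_of_add_eq_zero_left h1, eq_neg_of_add_eq_zero_left h2]; abel
    obtain ⟨z, hz, hzx⟩ := ex _ (B0.sub_mem (hx _) (hp _ (hy n).1)) key
    refine ⟨fun j => if j = n + 1 then z else y j, fun j => ?_, fun j hj => ?_⟩
    · dsimp only
      split_ifs with hj
      · exact ⟨hz, fun h => by push_cast at h; omega⟩
      · exact ⟨(hy j).1, fun h => (hy j).2 (by push_cast at h; omega)⟩
    · rcases eq_or_ne j (n+1) with rfl | hj0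
      · simp [hzx]
      · have h1 : j - 1 ≠ n + 1 := by push_cast at hj; omega
        simp only [hj0, h1, if_false]
        exact hyx j (by push_cast at hj; omega)

theorem ladder {A : Type*} [AddCommGroup A] (B0 B1 B2 : AddSubgroup A) (p q : A →+ A)
    (hp : ∀ x ∈ B1, p x ∈ B0) (hq : ∀ x ∈ B2, q x ∈ B1)
    (hpq : ∀ x, p (q x) + q (p x) = 0) (hpp : ∀ x, p (p x) = 0) (hqq : ∀ x, q (q x) = 0)
    (ex : ∀ x ∈ B0, q x = 0 → ∃ y ∈ B1, q y = x)
    (ex2 : ∀ y ∈ B1, p (q y) = 0 → ∃ s ∈ B2, ∃ t ∈ B2, y = p s + q t)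
    (n m : ℤ) (hn : 1 ≤ n) (hm : n = m + 1)
    (x : ℤ → A) (hx : x ∈ seqN B0 n) (h : shOp p q x = 0) :
    ∃ y ∈ seqN B1 m, shOp p q y = x := by
  have h' : ∀ j, p (x (j-1)) + q (x j) = 0 := fun j => congrFun h j
  lift n to ℕ using by omega
  obtain ⟨y, hy, hyx⟩ := ladder_aux B0 B1 p q hp hpq hpp ex x (fun j => (hx j).1)
    (fun j hj => (hx j).2 (Or.inl hj)) h' n
  have key : p (q (y n)) = 0 := by
    have h1 := h' (n+1)
    rw [(hx (n+1)).2 (by omega), add_sub_cancel_right, hyx n le_rfl] at h1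
    simpa [hpp] using h1
  obtain ⟨s, hs, t, ht, hst⟩ := ex2 _ (hy n).1 key
  refine ⟨fun j => if j = n then 0 else if j = n - 1 then y j - q s else y j, fun j => ?_, ?_⟩
  · dsimp only
    split_ifs with h1 h2
    · exact ⟨B1.zero_mem, fun _ => rfl⟩
    · exact ⟨B1.sub_mem (hy j).1 (hq _ hs), fun h => by omega⟩
    · exact ⟨(hy j).1, fun h => (hy j).2 (by omega)⟩
  · funext j
    rw [shOp_apply]
    rcases lt_trichotomy j n with hj | rfl | hj
    · have h1 : j - 1 ≠ n := by omega
      have h2 : j - 1 ≠ n - 1 := by omega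
      have h3 : j ≠ n := by omega
      simp only [h1, h2, h3, if_false]
      rw [hyx j hj.le]
      split_ifs
      · simp [hqq]
      · rfl
    · have h1 : (n:ℤ) - 1 ≠ n := by omega
      simp only [h1, if_false, if_true]
      rw [hyx n le_rfl, hst, map_add, hqq, map_sub, map_zero]
      rw [eq_neg_of_add_eq_zero_left (hpq s)]; abel
    · have h3 : j ≠ n := by omega
      have h4 : j ≠ n - 1 := by omega
      rw [(hx j).2 (by omega)]
      simp only [h3, h4, if_false, (hy j).2 (Or.inr hj), map_zero, add_zero]
      split_ifs with h5 h6
      · simp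
      · omega
      · rw [(hy _).2 (by omega)]; simp

theorem koszul {A : Type*} [AddCommGroup A] (B : AddSubgroup A) (p q dp dq : A →+ A)
    (hp : ∀ x ∈ B, p x ∈ B) (hq : ∀ x ∈ B, q x ∈ B)
    (hdp : ∀ x ∈ B, dp x ∈ B) (hdq : ∀ x ∈ B, dq x ∈ B)
    (hpq : ∀ x, p (q x) + q (p x) = 0) (hpp : ∀ x, p (p x) = 0) (hqq : ∀ x, q (q x) = 0)
    (hdpp : ∀ x, dp (p x) + p (dp x) = x) (hdqq : ∀ x, dq (q x) + q (dq x) = x)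
    (hdqp : ∀ x, dq (p x) + p (dq x) = 0)
    (n m : ℤ) (hn : 1 ≤ n) (hm : n = m + 1)
    (x : ℤ → A) (hx : x ∈ seqN B n) (h : shOp p q x = 0) :
    ∃ y ∈ seqN B m, shOp p q y = x := by
  refine ladder B B B p q hp hq hpq hpp hqq ?_ ?_ n m hn hm x hx h
  · intro x hx h
    refine ⟨dq x, hdq x hx, ?_⟩
    simpa [h] using hdqq x
  · intro y hy h
    have h1 : p (dp (q y)) = q y := by simpa [h] using hdpp (q y)
    refine ⟨-dq (dp (q y)), B.neg_mem (hdq _ (hdp _ (hq _ hy))), dq y, hdq _ hy, ?_⟩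
    have h2 := hdqp (dp (q y))
    have h3 := hdqq y
    rw [h1] at h2
    rw [map_neg, ← eq_neg_of_add_eq_zero_left h2, h3]

structure CARel {A : Type*} [AddCommGroup A] (p q r s κ dp dq dr ds : A →+ A) : Prop where
  pp : ∀ x, p (p x) = 0
  qq : ∀ x, q (q x) = 0
  rr : ∀ x, r (r x) = 0
  ss : ∀ x, s (s x) = 0
  pq : ∀ x, p (q x) = - q (p x)
  pr : ∀ x, p (r x) = - r (p x)
  qs : ∀ x, q (s x) = - s (q x)
  sr : ∀ x, s (r x) = - r (s x)
  ps : ∀ x, p (s x) = κ x - s (p x)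
  qr : ∀ x, q (r x) = - κ x - r (q x)
  pκ : ∀ x, p (κ x) = κ (p x)
  qκ : ∀ x, q (κ x) = κ (q x)
  rκ : ∀ x, r (κ x) = κ (r x)
  sκ : ∀ x, s (κ x) = κ (s x)
  drκ : ∀ x, dr (κ x) = κ (dr x)
  dsκ : ∀ x, ds (κ x) = κ (ds x)
  dqκ : ∀ x, dq (κ x) = κ (dq x)
  dpp : ∀ x, dp (p x) = x - p (dp x)
  dpq : ∀ x, dp (q x) = - q (dp x)
  dpr : ∀ x, dp (r x) = - r (dp x)
  dps : ∀ x, dp (s x) = - s (dp x)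
  dqp : ∀ x, dq (p x) = - p (dq x)
  dqq : ∀ x, dq (q x) = x - q (dq x)
  dqr : ∀ x, dq (r x) = - r (dq x)
  dqs : ∀ x, dq (s x) = - s (dq x)
  drp : ∀ x, dr (p x) = - p (dr x)
  drq : ∀ x, dr (q x) = - q (dr x)
  drr : ∀ x, dr (r x) = x - r (dr x)
  drs : ∀ x, dr (s x) = - s (dr x)
  dsp : ∀ x, ds (p x) = - p (ds x)
  dsq : ∀ x, ds (q x) = - q (ds x)
  dsr : ∀ x, ds (r x) = - r (ds x)
  dss : ∀ x, ds (s x) = x - s (ds x)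
  dcomm_pq : ∀ x, dp (dq x) = - dq (dp x)
  dcomm_pr : ∀ x, dp (dr x) = - dr (dp x)
  dcomm_ps : ∀ x, dp (ds x) = - ds (dp x)
  dcomm_qr : ∀ x, dq (dr x) = - dr (dq x)
  dcomm_qs : ∀ x, dq (ds x) = - ds (dq x)
  dcomm_rs : ∀ x, dr (ds x) = - ds (dr x)
  dr0 : ∀ x, dr (dr x) = 0
  ds0 : ∀ x, ds (ds x) = 0
  dq0 : ∀ x, dq (dq x) = 0

theorem CARel.swap {A : Type*} [AddCommGroup A] {p q r s κ dp dq dr ds : A →+ A}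
    (C : CARel p q r s κ dp dq dr ds) : CARel p r q s κ dp dr dq ds where
  pp := C.pp
  qq := C.rr
  rr := C.qq
  ss := C.ss
  pq := C.pr
  pr := C.pq
  qs x := by rw [C.sr, neg_neg]
  sr x := by rw [C.qs, neg_neg]
  ps := C.ps
  qr x := by rw [C.qr]; abel
  pκ := C.pκ
  qκ := C.rκ
  rκ := C.qκ
  sκ := C.sκ
  drκ := C.dqκ
  dsκ := C.dsκ
  dqκ := C.drκ
  dpp := C.dpp
  dpq := C.dpr
  dpr := C.dpq
  dps := C.dps
  dqp := C.drp
  dqq := C.drr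
  dqr := C.drq
  dqs := C.drs
  drp := C.dqp
  drq := C.dqr
  drr := C.dqq
  drs := C.dqs
  dsp := C.dsp
  dsq := C.dsr
  dsr := C.dsq
  dss := C.dss
  dcomm_pq := C.dcomm_pr
  dcomm_pr := C.dcomm_pq
  dcomm_ps := C.dcomm_ps
  dcomm_qr x := by rw [C.dcomm_qr, neg_neg]
  dcomm_qs := C.dcomm_rs
  dcomm_rs := C.dcomm_qs
  dr0 := C.dq0
  ds0 := C.ds0
  dq0 := C.dr0

/-- pointwise application -/
def seqMap {A : Type*} [AddCommGroup A] (φ : A →+ A) (x : ℤ → A) : ℤ → A := fun j => φ (x j)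

theorem seqMap_mem {A : Type*} [AddCommGroup A] {B B' : AddSubgroup A} {φ : A →+ A}
    (h : ∀ x ∈ B, φ x ∈ B') {n : ℤ} {x : ℤ → A} (hx : x ∈ seqN B n) : seqMap φ x ∈ seqN B' n :=
  fun j => ⟨h _ (hx j).1, fun hj => by rw [seqMap, (hx j).2 hj, map_zero]⟩

theorem seqN_split {A : Type*} [AddCommGroup A] {B : AddSubgroup A} {n m : ℤ} (hn : 1 ≤ n)
    (hm : n = m + 1) {x : ℤ → A} (hx : x ∈ seqN B n) :
    ∃ P ∈ seqN B m, ∃ Q ∈ seqN B m, ∀ j, x j = P (j-1) + Q j := by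
  refine ⟨fun j => if 0 ≤ j then x (j+1) else 0, fun j => ?_,
    fun j => if j = 0 then x 0 else 0, fun j => ?_, fun j => ?_⟩
  · dsimp only
    split_ifs with h
    · exact ⟨(hx _).1, fun h => (hx _).2 (by omega)⟩
    · exact ⟨B.zero_mem, fun _ => rfl⟩
  · dsimp only
    split_ifs with h
    · exact ⟨(hx _).1, fun h => by omega⟩
    · exact ⟨B.zero_mem, fun _ => rfl⟩
  · rcases lt_trichotomy j 0 with h | rfl | h
    · have h1 : ¬ (0 ≤ j - 1) := by omega
      have h2 : j ≠ 0 := by omega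
      simp [h1, h2, (hx j).2 (Or.inl h)]
    · simp
    · have h1 : (0 ≤ j - 1) := by omega
      have h2 : j ≠ 0 := by omega
      simp only [h1, h2, if_true, if_false]
      simp

/-- common kernel of `dr`, `ds` -/
def ker2 {A : Type*} [AddCommGroup A] (dr ds : A →+ A) : AddSubgroup A := dr.ker ⊓ ds.ker

theorem mem_ker2 {A : Type*} [AddCommGroup A] {dr ds : A →+ A} {x : A} :
    x ∈ ker2 dr ds ↔ dr x = 0 ∧ ds x = 0 := Iff.rfl

section
variable {A : Type*} [AddCommGroup A] {p q r s κ dp dq dr ds : A →+ A}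

theorem CARel.uniq (C : CARel p q r s κ dp dq dr ds) {a1 a2 a3 : A}
    (h1 : a1 ∈ ker2 dr ds) (h2 : a2 ∈ ker2 dr ds) (h3 : a3 ∈ ker2 dr ds)
    (h : r a1 + s a2 + r (s a3) = 0) : a2 = 0 ∧ a3 = 0 := by
  rw [mem_ker2] at h1 h2 h3
  have e1 := congrArg ds h
  simp only [map_add, map_neg, C.dsr, C.dss, h1.2, h2.2, h3.2, map_zero, sub_zero, neg_zero,
    zero_add] at e1
  have e2 := congrArg dr e1
  simp only [map_add, map_neg, C.drr, h2.1, h3.1, map_zero, sub_zero, zero_add, neg_eq_zero] at e2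
  subst e2
  simpa using e1

theorem CARel.kp (C : CARel p q r s κ dp dq dr ds) (x : A) (hx : x ∈ ker2 dr ds) :
    p x ∈ ker2 dr ds := by
  rw [mem_ker2] at hx ⊢; rw [C.drp, C.dsp, hx.1, hx.2]; simp

theorem CARel.kq (C : CARel p q r s κ dp dq dr ds) (x : A) (hx : x ∈ ker2 dr ds) :
    q x ∈ ker2 dr ds := by
  rw [mem_ker2] at hx ⊢; rw [C.drq, C.dsq, hx.1, hx.2]; simp

theorem CARel.kk (C : CARel p q r s κ dp dq dr ds) (x : A) (hx : x ∈ ker2 dr ds) :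
    κ x ∈ ker2 dr ds := by
  rw [mem_ker2] at hx ⊢; rw [C.drκ, C.dsκ, hx.1, hx.2]; simp

theorem CARel.kdp (C : CARel p q r s κ dp dq dr ds) (x : A) (hx : x ∈ ker2 dr ds) :
    dp x ∈ ker2 dr ds := by
  rw [mem_ker2] at hx ⊢
  rw [← neg_eq_zero, ← C.dcomm_pr, ← neg_eq_zero (a := ds _), ← C.dcomm_ps, hx.1, hx.2]; simp

theorem CARel.kdq (C : CARel p q r s κ dp dq dr ds) (x : A) (hx : x ∈ ker2 dr ds) :
    dq x ∈ ker2 dr ds := by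
  rw [mem_ker2] at hx ⊢
  rw [← neg_eq_zero, ← C.dcomm_qr, ← neg_eq_zero (a := ds _), ← C.dcomm_qs, hx.1, hx.2]; simp

theorem CARel.decomp (C : CARel p q r s κ dp dq dr ds) (n : ℤ) (g : ℤ → A) (hg : g ∈ seqN ⊤ n) :
    ∃ g0 ∈ seqN (ker2 dr ds) n, ∃ g1 ∈ seqN (ker2 dr ds) n, ∃ g2 ∈ seqN (ker2 dr ds) n,
    ∃ g3 ∈ seqN (ker2 dr ds) n, ∀ j, g j = g0 j + r (g1 j) + s (g2 j) + r (s (g3 j)) := by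
  refine ⟨seqMap (ds.comp (s.comp (dr.comp r))) g, seqMap_mem ?_ hg,
    seqMap (ds.comp (s.comp dr)) g, seqMap_mem ?_ hg,
    seqMap (ds.comp (dr.comp r)) g, seqMap_mem ?_ hg,
    seqMap (ds.comp dr) g, seqMap_mem ?_ hg, ?_⟩
  · intro x _
    rw [mem_ker2]
    simp [C.dcomm_rs, C.drs, C.drr, C.dr0, C.ds0]
  · intro x _
    rw [mem_ker2]
    simp [C.dcomm_rs, C.drs, C.drr, C.dr0, C.ds0]
  · intro x _
    rw [mem_ker2]
    simp [C.dcomm_rs, C.drs, C.drr, C.dr0, C.ds0]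
  · intro x _
    rw [mem_ker2]
    simp [C.dcomm_rs, C.drs, C.drr, C.dr0, C.ds0]
  · intro j
    simp only [seqMap, AddMonoidHom.comp_apply]
    simp only [C.dss, C.drr, map_sub]
    abel

theorem CARel.koszul0 (C : CARel p q r s κ dp dq dr ds)
    (n m : ℤ) (hn : 1 ≤ n) (hm : n = m + 1)
    (x : ℤ → A) (hx : x ∈ seqN (ker2 dr ds) n) (h : shOp p q x = 0) :
    ∃ y ∈ seqN (ker2 dr ds) m, shOp p q y = x :=
  koszul _ p q dp dq C.kp C.kq C.kdp C.kdq (fun x => by rw [C.pq]; abel) C.pp C.qq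
    (fun x => by rw [C.dpp]; abel) (fun x => by rw [C.dqq]; abel) (fun x => by rw [C.dqp]; abel)
    n m hn hm x hx h

theorem CARel.koszulT (C : CARel p q r s κ dp dq dr ds)
    (n m : ℤ) (hn : 1 ≤ n) (hm : n = m + 1)
    (x : ℤ → A) (hx : x ∈ seqN ⊤ n) (h : shOp r s x = 0) :
    ∃ y ∈ seqN ⊤ m, shOp r s y = x :=
  koszul ⊤ r s dr ds (fun _ _ => trivial) (fun _ _ => trivial) (fun _ _ => trivial)
    (fun _ _ => trivial) (fun x => by rw [C.sr]; abel) C.rr C.ss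
    (fun x => by rw [C.drr]; abel) (fun x => by rw [C.dss]; abel) (fun x => by rw [C.dsr]; abel)
    n m hn hm x hx h

theorem CARel.claim (C : CARel p q r s κ dp dq dr ds) (n m : ℤ) (hn : 1 ≤ n) (hm : n = m + 1)
    (g : ℤ → A) (hg : g ∈ seqN ⊤ n) (h : shOp r s (shOp p q g) = 0) :
    ∃ x ∈ seqN ⊤ m, ∃ y ∈ seqN ⊤ m, g = shOp p q x + shOp r s y := by
  have top : ∀ {φ : A →+ A}, ∀ x ∈ ker2 dr ds, φ x ∈ (⊤ : AddSubgroup A) := fun _ _ => trivial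
  obtain ⟨g0, hg0, g1, hg1, g2, hg2, g3, hg3, hd⟩ := C.decomp n g hg
  obtain ⟨P, hP, Q, hQ, hPQ⟩ := seqN_split hn hm hg3
  -- the reduced quantities
  let t : ℤ → A := fun j => g1 j - g2 (j-1)
  have ht : t ∈ seqN (ker2 dr ds) (n+1) := fun j =>
    ⟨AddSubgroup.sub_mem _ (hg1 _).1 (hg2 _).1, fun h => by
      simp only [t]; rw [(hg1 j).2 (by omega), (hg2 (j-1)).2 (by omega), sub_zero]⟩
  let e : ℤ → A := shOp p q g0 - seqMap κ t
  have he : e ∈ seqN (ker2 dr ds) (n+1) :=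
    AddSubgroup.sub_mem _ (shOp_mem C.kp C.kq rfl hg0) (seqMap_mem C.kk ht)
  have hat : shOp p q t ∈ seqN (ker2 dr ds) (n+1+1) := shOp_mem C.kp C.kq rfl ht
  have hu : ∀ j, r (e (j-1)) + s (e j) + r (s (shOp p q t j)) = 0 := by
    intro j
    have h1 := congrFun h j
    simp only [shOp_apply, hd, hPQ, Pi.zero_apply] at h1
    simp only [e, t, shOp_apply, seqMap, Pi.sub_apply]
    rw [← h1]
    simp only [map_add, map_sub, map_neg, C.pr, C.ps, C.qr, C.qs, C.sr, C.rr, C.ss, C.rκ, C.sκ, map_zero]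
    abel
  have hu1 : e = 0 := funext fun j => (C.uniq (he _).1 (he _).1 (hat _).1 (hu j)).1
  have hu2 : shOp p q t = 0 := funext fun j => (C.uniq (he _).1 (he _).1 (hat _).1 (hu j)).2
  obtain ⟨σ, hσ, hσt⟩ := C.koszul0 (n+1) n (by omega) rfl t ht hu2
  have h0 : shOp p q (g0 - seqMap κ σ) = 0 := by
    rw [← hu1]
    funext j
    simp only [e, ← hσt, shOp_apply, Pi.sub_apply, seqMap, map_sub, map_add, C.pκ, C.qκ]
    abel
  obtain ⟨ρ, hρ, hρg⟩ := C.koszul0 n m hn hm _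
    (AddSubgroup.sub_mem _ hg0 (seqMap_mem C.kk hσ)) h0
  obtain ⟨σ2, hσ2, σ1, hσ1, hσs⟩ := seqN_split hn hm hσ
  let k : ℤ → A := g2 + shOp p q σ2
  have hg1' : ∀ j, g1 j - shOp p q σ1 j = k (j-1) := by
    intro j
    have h1 := congrFun hσt j
    simp only [shOp_apply, hσs, t] at h1
    simp only [k, Pi.add_apply, shOp_apply]
    have h2 : g1 j = g2 (j-1) + (p (σ2 (j - 1 - 1) + σ1 (j - 1)) + q (σ2 (j - 1) + σ1 j)) := by
      rw [h1]; abel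
    rw [h2]; simp only [map_add]; abel
  have hk : k ∈ seqN ⊤ m := by
    intro j
    refine ⟨trivial, fun hj => ?_⟩
    rcases hj with hj | hj
    · simp only [k, Pi.add_apply, shOp_apply]
      rw [(hg2 j).2 (by omega), (hσ2 _).2 (by omega), (hσ2 _).2 (by omega)]; simp
    · have h1 := hg1' (j+1)
      rw [add_sub_cancel_right] at h1
      rw [← h1, shOp_apply, (hg1 _).2 (by omega), (hσ1 _).2 (by omega), (hσ1 _).2 (by omega)]
      simp
  have sub : seqN (ker2 dr ds) m ≤ seqN ⊤ m := fun x hx j => ⟨trivial, (hx j).2⟩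
  refine ⟨ρ - seqMap r σ1 + seqMap s σ2,
    AddSubgroup.add_mem _ (AddSubgroup.sub_mem _ (sub hρ) (seqMap_mem top hσ1))
      (seqMap_mem top hσ2),
    k + seqMap s P - seqMap r Q,
    AddSubgroup.sub_mem _ (AddSubgroup.add_mem _ hk (seqMap_mem top hP)) (seqMap_mem top hQ), ?_⟩
  funext j
  have h1 : g0 j = p (ρ (j-1)) + q (ρ j) + κ (σ2 (j-1) + σ1 j) := by
    have := congrFun hρg j
    simp only [shOp_apply, Pi.sub_apply, seqMap, hσs] at this
    rw [this]; abel
  have h2 : g1 j = k (j-1) + (p (σ1 (j-1)) + q (σ1 j)) := by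
    rw [← hg1', shOp_apply]; abel
  have h3 : g2 j = k j - (p (σ2 (j-1)) + q (σ2 j)) := by
    simp only [k, Pi.add_apply, shOp_apply]; abel
  rw [hd, hPQ, h1, h2, h3]
  simp only [shOp_apply, Pi.add_apply, Pi.sub_apply, seqMap, map_add, map_sub, map_neg, C.pr, C.ps,
    C.qr, C.qs, C.sr, C.rr, C.ss, map_zero]
  abel

theorem CARel.exact1 (C : CARel p q r s κ dp dq dr ds) (a b a' b' : ℤ) (ha : 2 ≤ a) (hb : 1 ≤ b)
    (ha' : a = a' + 1) (hb' : b = b' + 1)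
    (f : ℤ → ℤ → A) (hf : f ∈ seqN (seqN ⊤ a) b) (h : shOp (shOp p q) (shOp r s) f = 0) :
    ∃ g ∈ seqN (seqN ⊤ a') b', shOp (shOp p q) (shOp r s) g = f := by
  have anti : ∀ x, shOp p q (shOp r s x) = - shOp r s (shOp p q x) := by
    intro x
    funext j
    simp only [shOp_apply, Pi.neg_apply, map_add, map_sub, map_neg, C.pr, C.ps, C.qr, C.qs]
    abel
  refine ladder (seqN ⊤ a) (seqN ⊤ a') (seqN ⊤ (a'-1)) (shOp p q) (shOp r s) ?_ ?_ ?_ ?_ ?_ ?_ ?_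
    b b' hb hb' f hf h
  · exact fun x hx => shOp_mem (B' := ⊤) (fun _ _ => trivial) (fun _ _ => trivial) ha' hx
  · exact fun x hx => shOp_mem (B' := ⊤) (fun _ _ => trivial) (fun _ _ => trivial) (by omega) hx
  · intro x; rw [anti]; abel
  · intro x; funext j
    simp only [shOp_apply, map_add, C.pp, C.qq, C.pq, Pi.zero_apply]; abel
  · intro x; funext j
    simp only [shOp_apply, map_add, C.rr, C.ss, C.sr, Pi.zero_apply]; abel
  · exact fun x hx h => C.koszulT a a' (by omega) ha' x hx h
  · intro y hy h
    rw [anti, neg_eq_zero] at h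
    obtain ⟨x, hx, z, hz, e⟩ := C.claim a' (a'-1) (by omega) (by omega) y hy h
    exact ⟨x, hx, z, hz, e⟩

theorem CARel.exact2 (C : CARel p q r s κ dp dq dr ds) (a b a' b' : ℤ) (ha : 1 ≤ a) (hb : 1 ≤ b)
    (hne : ¬ (a = 1 ∧ b = 1)) (ha' : a = a' + 1) (hb' : b = b' + 1)
    (f : ℤ → ℤ → A) (hf : f ∈ seqN (seqN ⊤ a) b) (h : shOp (shOp p q) (shOp r s) f = 0) :
    ∃ g ∈ seqN (seqN ⊤ a') b', shOp (shOp p q) (shOp r s) g = f := by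
  by_cases h2 : 2 ≤ a
  · exact C.exact1 a b a' b' h2 hb ha' hb' f hf h
  · have flip : ∀ (f : ℤ → ℤ → A) (a b : ℤ), f ∈ seqN (seqN ⊤ a) b →
        (fun i j => f j i) ∈ seqN (seqN (⊤ : AddSubgroup A) b) a := by
      intro f a b hf i
      refine ⟨fun j => ⟨trivial, fun hj => ?_⟩, fun hi => ?_⟩
      · exact congrFun ((hf j).2 hj) i
      · funext j; exact ((hf j).1 i).2 hi
    obtain ⟨g, hg, e⟩ := C.swap.exact1 b a b' a' (by omega) ha hb' ha' (fun i j => f j i)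
      (flip f a b hf) (by
        funext i j
        have := congrFun (congrFun h j) i
        simp only [shOp_apply, Pi.add_apply, Pi.zero_apply] at this ⊢
        rw [← this]; abel)
    refine ⟨fun j i => g i j, flip g b' a' hg, ?_⟩
    funext j i
    have := congrFun (congrFun e i) j
    simp only [shOp_apply, Pi.add_apply] at this ⊢
    rw [← this]; abel

theorem CARel.sq (C : CARel p q r s κ dp dq dr ds) (f : ℤ → ℤ → A) :
    shOp (shOp p q) (shOp r s) (shOp (shOp p q) (shOp r s) f) = 0 := by
  funext j i
  simp only [shOp_apply, Pi.add_apply, Pi.zero_apply, map_add, C.pp, C.qq, C.rr, C.ss, C.pq, C.pr,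
    C.ps, C.qr, C.qs, C.sr]
  abel
end

/-- exponent vector -/
def exq (i k j l : ℕ) : Fin 4 →₀ ℕ := Finsupp.equivFunOnFinite.symm ![i, k, j, l]

def mono4 (i k j l : ℕ) : P4 := MvPolynomial.monomial (exq i k j l) 1

theorem X_mul_mono4 (i k j l : ℕ) :
    (MvPolynomial.X 0 * MvPolynomial.X 2 : P4) * mono4 i k j l = mono4 (i+1) k (j+1) l ∧
    (MvPolynomial.X 1 * MvPolynomial.X 2 : P4) * mono4 i k j l = mono4 i (k+1) (j+1) l ∧
    (MvPolynomial.X 0 * MvPolynomial.X 3 : P4) * mono4 i k j l = mono4 (i+1) k j (l+1) ∧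
    (MvPolynomial.X 1 * MvPolynomial.X 3 : P4) * mono4 i k j l = mono4 i (k+1) j (l+1) := by
  refine ⟨?_, ?_, ?_, ?_⟩ <;>
  · simp only [mono4, MvPolynomial.X, MvPolynomial.monomial_mul, mul_one]
    refine congrArg (fun m => MvPolynomial.monomial m (1:ℂ)) ?_
    refine Finsupp.ext fun n => ?_
    fin_cases n <;> simp [exq, Finsupp.single_apply, add_comm]

theorem exq_inj {i k j l i' k' j' l' : ℕ} (h : exq i k j l = exq i' k' j' l') :
    i = i' ∧ k = k' ∧ j = j' ∧ l = l' :=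
  ⟨DFunLike.congr_fun h 0, DFunLike.congr_fun h 1, DFunLike.congr_fun h 2, DFunLike.congr_fun h 3⟩

theorem weight_wu (m : Fin 4 →₀ ℕ) : Finsupp.weight wu m = m 0 + m 1 := by
  rw [Finsupp.weight_apply, Finsupp.sum_fintype _ _ (by simp)]
  simp [Fin.sum_univ_four, wu]

theorem weight_wv (m : Fin 4 →₀ ℕ) : Finsupp.weight wv m = m 2 + m 3 := by
  rw [Finsupp.weight_apply, Finsupp.sum_fintype _ _ (by simp)]
  simp [Fin.sum_univ_four, wv]

def PhiC (a b : ℕ) (f : ℤ → ℤ → Cl) : MCl :=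
  ∑ j ∈ Finset.range (b+1), ∑ i ∈ Finset.range (a+1), f j i ⊗ₜ[ℂ] mono4 i (a-i) j (b-j)

theorem PhiC_add (a b : ℕ) (f g : ℤ → ℤ → Cl) : PhiC a b (f + g) = PhiC a b f + PhiC a b g := by
  simp [PhiC, TensorProduct.add_tmul, Finset.sum_add_distrib]

theorem PhiC_mem (a b : ℕ) (f : ℤ → ℤ → Cl) : PhiC a b f ∈ MC a b := by
  refine Submodule.sum_mem _ fun j hj => Submodule.sum_mem _ fun i hi => Submodule.subset_span ?_
  rw [Finset.mem_range] at hi hj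
  refine ⟨_, _, ?_, ?_, rfl⟩
  · apply MvPolynomial.isWeightedHomogeneous_monomial
    rw [weight_wu]
    change i + (a - i) = a
    omega
  · apply MvPolynomial.isWeightedHomogeneous_monomial
    rw [weight_wv]
    change j + (b - j) = b
    omega

theorem PhiC_single (a b : ℕ) (i j : ℕ) (hi : i ≤ a) (hj : j ≤ b) (c : Cl) :
    PhiC a b (fun j' i' => if j' = j then (if i' = i then c else 0) else 0) =
      c ⊗ₜ[ℂ] mono4 i (a-i) j (b-j) := by
  unfold PhiC
  rw [Finset.sum_eq_single j, Finset.sum_eq_single i]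
  · simp
  · intro i' _ h
    simp [h]
  · intro h; exact absurd (Finset.mem_range.2 (by omega)) h
  · intro j' _ h
    simp [h]
  · intro h; exact absurd (Finset.mem_range.2 (by omega)) h

theorem PhiC_surj (a b : ℕ) (z : MCl) (hz : z ∈ MC a b) :
    ∃ f ∈ seqN (seqN (⊤ : AddSubgroup Cl) a) b, PhiC a b f = z := by
  let W : AddSubmonoid MCl :=
    { carrier := {z | ∃ f ∈ seqN (seqN (⊤ : AddSubgroup Cl) a) b, PhiC a b f = z}
      zero_mem' := ⟨0, AddSubgroup.zero_mem _, by simp [PhiC]⟩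
      add_mem' := by
        rintro _ _ ⟨f, hf, rfl⟩ ⟨g, hg, rfl⟩
        exact ⟨f + g, AddSubgroup.add_mem _ hf hg, PhiC_add a b f g⟩ }
  change z ∈ W
  have gen : ∀ (c : Cl) (q : P4), MvPolynomial.IsWeightedHomogeneous wu q a →
      MvPolynomial.IsWeightedHomogeneous wv q b → c ⊗ₜ[ℂ] q ∈ W := by
    intro c q hu hv
    rw [MvPolynomial.as_sum q, TensorProduct.tmul_sum]
    refine AddSubmonoid.sum_mem _ fun m hm => ?_
    have hc := MvPolynomial.mem_support_iff.1 hm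
    have h1 := hu hc
    have h2 := hv hc
    rw [weight_wu] at h1
    rw [weight_wv] at h2
    have e1 : m = exq (m 0) (a - m 0) (m 2) (b - m 2) := by
      ext n
      fin_cases n
      · rfl
      · change m 1 = a - m 0
        omega
      · rfl
      · change m 3 = b - m 2
        omega
    have e2 : c ⊗ₜ[ℂ] MvPolynomial.monomial m (MvPolynomial.coeff m q) =
        (MvPolynomial.coeff m q • c) ⊗ₜ[ℂ] mono4 (m 0) (a - m 0) (m 2) (b - m 2) := by
      rw [mono4, ← e1, TensorProduct.smul_tmul, MvPolynomial.smul_monomial, smul_eq_mul, mul_one]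
    rw [e2]
    refine ⟨_, ?_, PhiC_single a b (m 0) (m 2) (by omega) (by omega) _⟩
    intro j
    refine ⟨fun i => ⟨trivial, fun hi => ?_⟩, fun hj => ?_⟩
    · dsimp only
      have : ¬ (i = (m 0 : ℤ)) := by omega
      simp [this]
    · funext i
      have : ¬ (j = (m 2 : ℤ)) := by omega
      simp [this]
  refine Submodule.span_induction (p := fun z _ => z ∈ W) ?_ W.zero_mem
    (fun x y _ _ hx hy => W.add_mem hx hy) ?_ hz
  · rintro _ ⟨c, q, hu, hv, rfl⟩
    exact gen c q hu hv
  · rintro t _ _ ⟨f, hf, rfl⟩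
    refine ⟨fun j i => t • f j i, fun j => ⟨fun i => ⟨trivial, fun hi => ?_⟩, fun hj => ?_⟩, ?_⟩
    · simp only [((hf j).1 i).2 hi, smul_zero]
    · funext i
      simp only [(hf j).2 hj, Pi.zero_apply, smul_zero]
    · simp only [PhiC, Finset.smul_sum, TensorProduct.smul_tmul']

def coefC (m : Fin 4 →₀ ℕ) : MCl →ₗ[ℂ] Cl :=
  (TensorProduct.rid ℂ Cl).toLinearMap ∘ₗ LinearMap.lTensor Cl (MvPolynomial.lcoeff ℂ m)

theorem coefC_tmul (m m' : Fin 4 →₀ ℕ) (c : Cl) :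
    coefC m (c ⊗ₜ[ℂ] MvPolynomial.monomial m' 1) = if m' = m then c else 0 := by
  classical
  simp [coefC, MvPolynomial.coeff_monomial]

theorem PhiC_inj (a b : ℕ) (f : ℤ → ℤ → Cl) (hf : f ∈ seqN (seqN (⊤ : AddSubgroup Cl) a) b)
    (h : PhiC a b f = 0) : f = 0 := by
  funext j i
  by_cases hj : j < 0 ∨ (b:ℤ) < j
  · rw [(hf j).2 hj]; rfl
  by_cases hi : i < 0 ∨ (a:ℤ) < i
  · rw [((hf j).1 i).2 hi]; rfl
  lift j to ℕ using by omega
  lift i to ℕ using by omega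
  have h1 := congrArg (coefC (exq i (a-i) j (b-j))) h
  rw [map_zero, PhiC, map_sum, Finset.sum_eq_single j, map_sum, Finset.sum_eq_single i] at h1
  · simpa [mono4, coefC_tmul] using h1
  · intro i' _ hne
    rw [mono4, coefC_tmul, if_neg]
    exact fun e => hne (exq_inj e).1
  · intro h; exact absurd (Finset.mem_range.2 (by omega)) h
  · intro j' _ hne
    rw [map_sum]
    refine Finset.sum_eq_zero fun i' _ => ?_
    rw [mono4, coefC_tmul, if_neg]
    exact fun e => hne (exq_inj e).2.2.1
  · intro h; exact absurd (Finset.mem_range.2 (by omega)) h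

abbrev rm (w : Cl) : Cl →+ Cl := AddMonoidHom.mulRight w

abbrev DC : (ℤ → ℤ → Cl) →+ (ℤ → ℤ → Cl) := shOp (shOp (rm w11) (rm w21)) (shOp (rm w12) (rm w22))

theorem sum_shift_up {M : Type*} [AddCommMonoid M] (a : ℕ) (F : ℤ → ℕ → ℕ → M)
    (h : F (-1) 0 (a + 1) = 0) :
    ∑ i ∈ Finset.range (a+1+1), F ((i:ℤ) - 1) i (a+1-i) =
      ∑ i ∈ Finset.range (a+1), F i (i+1) (a-i) := by
  rw [Finset.sum_range_succ']
  simp [h]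

theorem sum_shift_in {M : Type*} [AddCommMonoid M] (a : ℕ) (F : ℤ → ℕ → ℕ → M)
    (h : F (a+1) (a+1) 0 = 0) :
    ∑ i ∈ Finset.range (a+1+1), F i i (a+1-i) =
      ∑ i ∈ Finset.range (a+1), F i i (a-i+1) := by
  rw [Finset.sum_range_succ]
  simp only [Nat.cast_add, Nat.cast_one, Nat.sub_self, h, add_zero]
  refine Finset.sum_congr rfl fun i hi => ?_
  rw [Finset.mem_range] at hi
  rw [show a + 1 - i = a - i + 1 by omega]

theorem nabla_Phi (a b : ℕ) (f : ℤ → ℤ → Cl) (hf : f ∈ seqN (seqN (⊤ : AddSubgroup Cl) a) b) :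
    nablaC (PhiC a b f) = PhiC (a+1) (b+1) (DC f) := by
  have f1 : ∀ i, f (-1) i = 0 := fun i => congrFun ((hf (-1)).2 (by omega)) i
  have f2 : ∀ i, f (b+1) i = 0 := fun i => congrFun ((hf (b+1)).2 (by omega)) i
  have f3 : ∀ j, f j (-1) = 0 := fun j => ((hf j).1 _).2 (by omega)
  have f4 : ∀ j, f j (a+1) = 0 := fun j => ((hf j).1 _).2 (by omega)
  have L : nablaC (PhiC a b f) =
      ∑ j ∈ Finset.range (b+1), ∑ i ∈ Finset.range (a+1),
        ((f j i * w11) ⊗ₜ[ℂ] mono4 (i+1) (a-i) (j+1) (b-j) +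
         (f j i * w21) ⊗ₜ[ℂ] mono4 i (a-i+1) (j+1) (b-j) +
         (f j i * w12) ⊗ₜ[ℂ] mono4 (i+1) (a-i) j (b-j+1) +
         (f j i * w22) ⊗ₜ[ℂ] mono4 i (a-i+1) j (b-j+1)) := by
    rw [PhiC, map_sum]
    refine Finset.sum_congr rfl fun j _ => ?_
    rw [map_sum]
    refine Finset.sum_congr rfl fun i _ => ?_
    obtain ⟨e1, e2, e3, e4⟩ := X_mul_mono4 i (a-i) j (b-j)
    simp only [nablaC, LinearMap.add_apply, TensorProduct.map_tmul, LinearMap.mulRight_apply,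
      LinearMap.mulLeft_apply, e1, e2, e3, e4]
  rw [L]
  simp only [PhiC, DC, shOp_apply, Pi.add_apply, AddMonoidHom.mulRight_apply,
    TensorProduct.add_tmul, Finset.sum_add_distrib]
  have u1 : ∀ (w : Cl) (j : ℤ) (k l : ℕ),
      ∑ i ∈ Finset.range (a+1+1), (f j ((i:ℤ)-1) * w) ⊗ₜ[ℂ] mono4 i (a+1-i) k l =
      ∑ i ∈ Finset.range (a+1), (f j i * w) ⊗ₜ[ℂ] mono4 (i+1) (a-i) k l := fun w j k l =>
    sum_shift_up a (fun i m n => (f j i * w) ⊗ₜ[ℂ] mono4 m n k l) (by simp [f3])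
  have u2 : ∀ (w : Cl) (j : ℤ) (k l : ℕ),
      ∑ i ∈ Finset.range (a+1+1), (f j (i:ℤ) * w) ⊗ₜ[ℂ] mono4 i (a+1-i) k l =
      ∑ i ∈ Finset.range (a+1), (f j i * w) ⊗ₜ[ℂ] mono4 i (a-i+1) k l := fun w j k l =>
    sum_shift_in a (fun i m n => (f j i * w) ⊗ₜ[ℂ] mono4 m n k l) (by simp [f4])
  simp only [u1, u2]
  rw [sum_shift_up b (fun j m n => ∑ i ∈ Finset.range (a+1),
      (f j i * w11) ⊗ₜ[ℂ] mono4 (i+1) (a-i) m n) (by simp [f1]),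
    sum_shift_up b (fun j m n => ∑ i ∈ Finset.range (a+1),
      (f j i * w21) ⊗ₜ[ℂ] mono4 i (a-i+1) m n) (by simp [f1]),
    sum_shift_in b (fun j m n => ∑ i ∈ Finset.range (a+1),
      (f j i * w12) ⊗ₜ[ℂ] mono4 (i+1) (a-i) m n) (by simp [f2]),
    sum_shift_in b (fun j m n => ∑ i ∈ Finset.range (a+1),
      (f j i * w22) ⊗ₜ[ℂ] mono4 i (a-i+1) m n) (by simp [f2])]
  abel

open Polynomial in
/-- the vector of coordinates -/
def vecC (x0 x1 x2 x3 : ℂ) : Fin 4 → Polynomial ℂ := ![C x0, C x1, C x2, C x3]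

def dualC (x0 x1 x2 x3 : ℂ) : Module.Dual (Polynomial ℂ) (Fin 4 → Polynomial ℂ) :=
  ∑ i, (vecC x0 x1 x2 x3 i) • LinearMap.proj i

theorem dualC_vecC (x0 x1 x2 x3 y0 y1 y2 y3 : ℂ) :
    dualC x0 x1 x2 x3 (vecC y0 y1 y2 y3) = Polynomial.C (x0*y0+x1*y1+x2*y2+x3*y3) := by
  simp [dualC, vecC, Fin.sum_univ_four]

theorem Qf_vecC (y0 y1 y2 y3 : ℂ) :
    Qf (vecC y0 y1 y2 y3) = Polynomial.C (y0*y0+y1*y1+y2*y2+y3*y3) * Polynomial.X := by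
  simp [Qf, vecC, Fin.sum_univ_four, QuadraticMap.weightedSumSquares_apply]
  ring

theorem vecC_add (x0 x1 x2 x3 y0 y1 y2 y3 : ℂ) :
    vecC x0 x1 x2 x3 + vecC y0 y1 y2 y3 = vecC (x0+y0) (x1+y1) (x2+y2) (x3+y3) := by
  funext i; fin_cases i <;> simp [vecC]

theorem polar_vecC (x0 x1 x2 x3 y0 y1 y2 y3 : ℂ) :
    QuadraticMap.polar Qf (vecC x0 x1 x2 x3) (vecC y0 y1 y2 y3) =
      Polynomial.C (2*(x0*y0+x1*y1+x2*y2+x3*y3)) * Polynomial.X := by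
  rw [QuadraticMap.polar, vecC_add, Qf_vecC, Qf_vecC, Qf_vecC, ← sub_mul, ← sub_mul, ← map_sub,
    ← map_sub]
  congr 2
  ring

theorem ii_mul_ι (v : Fin 4 → Polynomial ℂ) : ii * CliffordAlgebra.ι Qf v =
    CliffordAlgebra.ι Qf (Polynomial.C Complex.I • v) := by
  rw [map_smul, Algebra.smul_def]
  rfl

theorem w11_eq : w11 = CliffordAlgebra.ι Qf (vecC Complex.I 1 0 0) := by
  rw [w11, η, η, ii_mul_ι, ← map_add]
  congr 1
  funext i; fin_cases i <;> simp [vecC]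

theorem w22_eq : w22 = CliffordAlgebra.ι Qf (vecC (-Complex.I) 1 0 0) := by
  rw [w22, η, η, ii_mul_ι, ← map_sub]
  congr 1
  funext i; fin_cases i <;> simp [vecC]

theorem w12_eq : w12 = CliffordAlgebra.ι Qf (vecC 0 0 Complex.I (-1)) := by
  rw [w12, η, η, ii_mul_ι, ← map_neg, ← map_add]
  congr 1
  funext i; fin_cases i <;> simp [vecC]

theorem w21_eq : w21 = CliffordAlgebra.ι Qf (vecC 0 0 Complex.I 1) := by
  rw [w21, η, η, ii_mul_ι, ← map_add]
  congr 1
  funext i; fin_cases i <;> simp [vecC]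

/-- right contraction -/
def rc (d : Module.Dual (Polynomial ℂ) (Fin 4 → Polynomial ℂ)) : Cl →+ Cl :=
  ((CliffordAlgebra.contractRight (Q := Qf)).flip d).toAddMonoidHom

theorem rc_apply (d : Module.Dual (Polynomial ℂ) (Fin 4 → Polynomial ℂ)) (x : Cl) :
    rc d x = CliffordAlgebra.contractRight (Q := Qf) x d := rfl

def kapC : Cl := algebraMap (Polynomial ℂ) Cl (Polynomial.C 4 * Polynomial.X)

theorem rm_anti (v v' : Fin 4 → Polynomial ℂ) (x : Cl) :
    rm (CliffordAlgebra.ι Qf v) (rm (CliffordAlgebra.ι Qf v') x) =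
    x * algebraMap (Polynomial ℂ) Cl (QuadraticMap.polar Qf v v') -
      rm (CliffordAlgebra.ι Qf v') (rm (CliffordAlgebra.ι Qf v) x) := by
  simp only [AddMonoidHom.mulRight_apply]
  rw [← CliffordAlgebra.ι_mul_ι_add_swap, mul_add, mul_assoc, mul_assoc]
  abel

theorem rm_sq (v : Fin 4 → Polynomial ℂ) (x : Cl) (h : Qf v = 0) :
    rm (CliffordAlgebra.ι Qf v) (rm (CliffordAlgebra.ι Qf v) x) = 0 := by
  simp only [AddMonoidHom.mulRight_apply]
  rw [mul_assoc, CliffordAlgebra.ι_sq_scalar, h, map_zero, mul_zero]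

theorem rm_comm_kap (w x : Cl) : rm w (rm kapC x) = rm kapC (rm w x) := by
  simp only [AddMonoidHom.mulRight_apply]
  rw [mul_assoc, mul_assoc, kapC, Algebra.commutes]

theorem rc_kap (d : Module.Dual (Polynomial ℂ) (Fin 4 → Polynomial ℂ)) (x : Cl) :
    rc d (rm kapC x) = rm kapC (rc d x) := by
  simp only [AddMonoidHom.mulRight_apply, rc_apply, kapC]
  rw [CliffordAlgebra.contractRight_mul_algebraMap]

theorem rc_rm (d : Module.Dual (Polynomial ℂ) (Fin 4 → Polynomial ℂ))
    (v : Fin 4 → Polynomial ℂ) (x : Cl) :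
    rc d (rm (CliffordAlgebra.ι Qf v) x) = d v • x - rm (CliffordAlgebra.ι Qf v) (rc d x) := by
  simp only [AddMonoidHom.mulRight_apply, rc_apply]
  rw [CliffordAlgebra.contractRight_mul_ι]

theorem rc_anti (d d' : Module.Dual (Polynomial ℂ) (Fin 4 → Polynomial ℂ)) (x : Cl) :
    rc d (rc d' x) = - rc d' (rc d x) := by
  simp only [rc_apply]
  rw [CliffordAlgebra.contractRight_comm]

theorem rc_sq (d : Module.Dual (Polynomial ℂ) (Fin 4 → Polynomial ℂ)) (x : Cl) :
    rc d (rc d x) = 0 := by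
  simp only [rc_apply]
  rw [CliffordAlgebra.contractRight_contractRight]

theorem rm_anti0 {v v' : Fin 4 → Polynomial ℂ} (h : QuadraticMap.polar Qf v v' = 0) (x : Cl) :
    rm (CliffordAlgebra.ι Qf v) (rm (CliffordAlgebra.ι Qf v') x) =
      - rm (CliffordAlgebra.ι Qf v') (rm (CliffordAlgebra.ι Qf v) x) := by
  rw [rm_anti, h, map_zero, mul_zero, zero_sub]

theorem rc_rm0 {d : Module.Dual (Polynomial ℂ) (Fin 4 → Polynomial ℂ)}
    {v : Fin 4 → Polynomial ℂ} (h : d v = 0) (x : Cl) :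
    rc d (rm (CliffordAlgebra.ι Qf v) x) = - rm (CliffordAlgebra.ι Qf v) (rc d x) := by
  rw [rc_rm, h, zero_smul, zero_sub]

theorem rc_rm1 {d : Module.Dual (Polynomial ℂ) (Fin 4 → Polynomial ℂ)}
    {v : Fin 4 → Polynomial ℂ} (h : d v = 1) (x : Cl) :
    rc d (rm (CliffordAlgebra.ι Qf v) x) = x - rm (CliffordAlgebra.ι Qf v) (rc d x) := by
  rw [rc_rm, h, one_smul]

theorem dual0 {x0 x1 x2 x3 y0 y1 y2 y3 : ℂ} (h : x0*y0+x1*y1+x2*y2+x3*y3 = 0) :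
    dualC x0 x1 x2 x3 (vecC y0 y1 y2 y3) = 0 := by rw [dualC_vecC, h, map_zero]
theorem dual1 {x0 x1 x2 x3 y0 y1 y2 y3 : ℂ} (h : x0*y0+x1*y1+x2*y2+x3*y3 = 1) :
    dualC x0 x1 x2 x3 (vecC y0 y1 y2 y3) = 1 := by rw [dualC_vecC, h, map_one]
theorem Qf0 {y0 y1 y2 y3 : ℂ} (h : y0*y0+y1*y1+y2*y2+y3*y3 = 0) :
    Qf (vecC y0 y1 y2 y3) = 0 := by rw [Qf_vecC, h, map_zero, zero_mul]
theorem polar0 {x0 x1 x2 x3 y0 y1 y2 y3 : ℂ} (h : x0*y0+x1*y1+x2*y2+x3*y3 = 0) :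
    QuadraticMap.polar Qf (vecC x0 x1 x2 x3) (vecC y0 y1 y2 y3) = 0 := by
  rw [polar_vecC, h]; simp

theorem carC : CARel (rm w11) (rm w21) (rm w12) (rm w22) (rm kapC)
    (rc (dualC (-Complex.I/2) (1/2) 0 0)) (rc (dualC 0 0 (-Complex.I/2) (1/2)))
    (rc (dualC 0 0 (-Complex.I/2) (-1/2))) (rc (dualC (Complex.I/2) (1/2) 0 0)) := by
  have hI : Complex.I * Complex.I = -1 := Complex.I_mul_I
  rw [w11_eq, w21_eq, w12_eq, w22_eq]
  have hpp := fun x => rm_sq _ x (Qf0 (y0 := Complex.I) (y1 := 1) (y2 := 0) (y3 := 0) (by linear_combination hI))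
  have hqq := fun x => rm_sq _ x (Qf0 (y0 := 0) (y1 := 0) (y2 := Complex.I) (y3 := 1) (by linear_combination hI))
  have hrr := fun x => rm_sq _ x (Qf0 (y0 := 0) (y1 := 0) (y2 := Complex.I) (y3 := -1) (by linear_combination hI))
  have hss := fun x => rm_sq _ x (Qf0 (y0 := -Complex.I) (y1 := 1) (y2 := 0) (y3 := 0) (by linear_combination hI))
  exact
  { pp := hpp
    qq := hqq
    rr := hrr
    ss := hss
    pq := rm_anti0 (polar0 (by simp))
    pr := rm_anti0 (polar0 (by simp))
    qs := rm_anti0 (polar0 (by simp))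
    sr := rm_anti0 (polar0 (by simp))
    ps := fun x => by
      rw [rm_anti, polar_vecC, show rm kapC x = x * kapC from rfl, kapC]
      congr 5
      linear_combination (-2) * hI
    qr := fun x => by
      rw [rm_anti, polar_vecC, show rm kapC x = x * kapC from rfl, kapC, ← mul_neg, ← map_neg, ← neg_mul, ← map_neg]
      congr 5
      linear_combination (2) * hI
    pκ := rm_comm_kap _
    qκ := rm_comm_kap _
    rκ := rm_comm_kap _
    sκ := rm_comm_kap _
    drκ := rc_kap _
    dsκ := rc_kap _
    dqκ := rc_kap _
    dpp := rc_rm1 (dual1 (by linear_combination (-1/2) * hI))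
    dpq := rc_rm0 (dual0 (by first | (simp; done) | linear_combination (1/2) * hI | linear_combination (-1/2) * hI))
    dpr := rc_rm0 (dual0 (by first | (simp; done) | linear_combination (1/2) * hI | linear_combination (-1/2) * hI))
    dps := rc_rm0 (dual0 (by first | (simp; done) | linear_combination (1/2) * hI | linear_combination (-1/2) * hI))
    dqp := rc_rm0 (dual0 (by first | (simp; done) | linear_combination (1/2) * hI | linear_combination (-1/2) * hI))
    dqq := rc_rm1 (dual1 (by linear_combination (-1/2) * hI))
    dqr := rc_rm0 (dual0 (by first | (simp; done) | linear_combination (1/2) * hI | linear_combination (-1/2) * hI))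
    dqs := rc_rm0 (dual0 (by first | (simp; done) | linear_combination (1/2) * hI | linear_combination (-1/2) * hI))
    drp := rc_rm0 (dual0 (by first | (simp; done) | linear_combination (1/2) * hI | linear_combination (-1/2) * hI))
    drq := rc_rm0 (dual0 (by first | (simp; done) | linear_combination (1/2) * hI | linear_combination (-1/2) * hI))
    drr := rc_rm1 (dual1 (by linear_combination (-1/2) * hI))
    drs := rc_rm0 (dual0 (by first | (simp; done) | linear_combination (1/2) * hI | linear_combination (-1/2) * hI))
    dsp := rc_rm0 (dual0 (by first | (simp; done) | linear_combination (1/2) * hI | linear_combination (-1/2) * hI))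
    dsq := rc_rm0 (dual0 (by first | (simp; done) | linear_combination (1/2) * hI | linear_combination (-1/2) * hI))
    dsr := rc_rm0 (dual0 (by first | (simp; done) | linear_combination (1/2) * hI | linear_combination (-1/2) * hI))
    dss := rc_rm1 (dual1 (by linear_combination (-1/2) * hI))
    dcomm_pq := rc_anti _ _
    dcomm_pr := rc_anti _ _
    dcomm_ps := rc_anti _ _
    dcomm_qr := rc_anti _ _
    dcomm_qs := rc_anti _ _
    dcomm_rs := rc_anti _ _
    dr0 := rc_sq _
    ds0 := rc_sq _
    dq0 := rc_sq _ }

/-- for `a, b ≥ 1` with `(a,b) ≠ (1,1)`,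
`ker(∇ : M_C^{(a,b)} → M_C^{(a+1,b+1)}) = ∇(M_C^{(a−1,b−1)})`: the quadrant-C
complexes are exact at every interior point except `M(1,1,3,0)`. -/
theorem quadrantC_exact (a b : ℕ) (ha : 1 ≤ a) (hb : 1 ≤ b) (hne : ¬(a = 1 ∧ b = 1)) :
    MC a b ⊓ LinearMap.ker nablaC = Submodule.map nablaC (MC (a - 1) (b - 1)) := by
  obtain ⟨a', rfl⟩ : ∃ a', a = a' + 1 := ⟨a - 1, by omega⟩
  obtain ⟨b', rfl⟩ : ∃ b', b = b' + 1 := ⟨b - 1, by omega⟩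
  simp only [Nat.add_sub_cancel]
  have dmem : ∀ (m n : ℕ) (f : ℤ → ℤ → Cl), f ∈ seqN (seqN (⊤ : AddSubgroup Cl) m) n →
      DC f ∈ seqN (seqN (⊤ : AddSubgroup Cl) ((m + 1 : ℕ) : ℤ)) ((n + 1 : ℕ) : ℤ) := by
    intro m n f hf
    exact shOp_mem
      (fun x hx => shOp_mem (B' := ⊤) (fun _ _ => trivial) (fun _ _ => trivial) (by push_cast; rfl) hx)
      (fun x hx => shOp_mem (B' := ⊤) (fun _ _ => trivial) (fun _ _ => trivial) (by push_cast; rfl) hx)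
      (by push_cast; rfl) hf
  apply le_antisymm
  · rintro z ⟨hz, hk⟩
    obtain ⟨f, hf, rfl⟩ := PhiC_surj _ _ z hz
    have hk' : nablaC (PhiC (a'+1) (b'+1) f) = 0 := hk
    rw [nabla_Phi _ _ f hf] at hk'
    have h0 := PhiC_inj _ _ _ (dmem _ _ f hf) hk'
    obtain ⟨g, hg, e⟩ := carC.exact2 ((a' + 1 : ℕ) : ℤ) ((b' + 1 : ℕ) : ℤ) a' b'
      (by omega) (by omega) (by omega) (by push_cast; rfl) (by push_cast; rfl) f hf h0
    refine ⟨PhiC a' b' g, PhiC_mem _ _ _, ?_⟩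
    rw [nabla_Phi _ _ g hg]
    exact congrArg _ e
  · rintro _ ⟨z, hz, rfl⟩
    obtain ⟨g, hg, rfl⟩ := PhiC_surj _ _ z hz
    rw [nabla_Phi _ _ g hg]
    refine ⟨PhiC_mem _ _ _, ?_⟩
    change nablaC _ = 0
    rw [nabla_Phi _ _ _ (dmem _ _ g hg), DC, carC.sq g]
    simp [PhiC]

end
end

section
/- The quotient ker(∇ : M_C^{(1,1)} → M_C^{(2,2)}) / ∇(M_C^{(0,0)}) is a one-dimensional ℂ-vector space; that is, the homology of the quadrant-C complex at the module M(1,1,3,0) is isomorphic to the trivial representation. Moreover ∇ : M_C^{(0,0)} → M_C^{(1,1)} is injective, so the homology at M(0,0,2,0) vanishes. -/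
/- Setup: `Cl` is the Clifford algebra over `ℂ[Θ]` realizing `U(𝔤₍<₀₎)` for
`𝒜(K′₄)`, with `w11, w22, w12, w21` as in the paper.  On `Cl ⊗[ℂ] ℂ[u₁,u₂,v₁,v₂]`
(variables `X 0, X 1 = u₁, u₂` and `X 2, X 3 = v₁, v₂`) we define
`∇(c ⊗ q) = c·w₁₁ ⊗ u₁v₁q + c·w₂₁ ⊗ u₂v₁q + c·w₁₂ ⊗ u₁v₂q + c·w₂₂ ⊗ u₂v₂q`,
and `MC a b = Cl ⊗ (bihomogeneous polynomials of degree a in u and b in v)` is the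
finite Verma module `M(a,b,(a+b)/2+2,(b−a)/2)` of quadrant C. -/

set_option synthInstance.maxHeartbeats 1000000
set_option maxHeartbeats 1000000

noncomputable section

open scoped TensorProduct

namespace HM

abbrev R := Polynomial ℂ
abbrev V := Bool → Bool → Bool → Bool → R

def s (b : Bool) : R := if b then -1 else 1
def th (b : Bool) : R := if b then 1 else Polynomial.X

def T (m : Fin 4 → R) : V →ₗ[R] V where
  toFun v := fun a b c d =>
    m 0 * (s b * s c * s d * th a * v (!a) b c d) + m 1 * (s c * s d * th b * v a (!b) c d)
    + m 2 * (s d * th c * v a b (!c) d) + m 3 * (th d * v a b c (!d))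
  map_add' v w := by
    funext a b c d; simp only [Pi.add_apply]; ring
  map_smul' r v := by
    funext a b c d; simp only [Pi.smul_apply, smul_eq_mul, RingHom.id_apply]; ring

def Tl : (Fin 4 → R) →ₗ[R] (Module.End R V)ᵐᵒᵖ where
  toFun m := MulOpposite.op (T m)
  map_add' v w := by
    rw [← MulOpposite.op_add]; congr 1
    refine LinearMap.ext fun x => ?_
    funext a b c d
    simp only [T, LinearMap.coe_mk, AddHom.coe_mk, LinearMap.add_apply, Pi.add_apply]; ring
  map_smul' r v := by
    rw [RingHom.id_apply, ← MulOpposite.op_smul]; congr 1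
    refine LinearMap.ext fun x => ?_
    funext a b c d
    simp only [T, LinearMap.coe_mk, AddHom.coe_mk, LinearMap.smul_apply, Pi.smul_apply, smul_eq_mul]; ring

theorem Qf_apply (m : Fin 4 → R) :
    Qf m = Polynomial.X * (m 0 * m 0 + m 1 * m 1 + m 2 * m 2 + m 3 * m 3) := by
  simp [Qf, QuadraticMap.weightedSumSquares_apply, Fin.sum_univ_four]; ring

theorem T_sq (m : Fin 4 → R) (v : V) : T m (T m v) = Qf m • v := by
  rw [Qf_apply]
  funext a b c d
  simp only [T, LinearMap.coe_mk, AddHom.coe_mk, Pi.smul_apply, smul_eq_mul]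
  cases a <;> cases b <;> cases c <;> cases d <;> simp [s, th] <;> ring

def ρ : Cl →ₐ[R] (Module.End R V)ᵐᵒᵖ :=
  CliffordAlgebra.lift Qf ⟨Tl, by
    intro m
    apply MulOpposite.unop_injective
    refine LinearMap.ext fun v => ?_
    have := T_sq m v
    simpa [Tl, Algebra.algebraMap_eq_smul_one] using this⟩

def e0 : V := fun a b c d => if a || b || c || d then 0 else 1

def f : Cl →ₗ[R] V where
  toFun x := (ρ x).unop e0
  map_add' x y := by simp
  map_smul' r x := by simp

theorem f_mul_ι (x : Cl) (m : Fin 4 → R) :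
    f (x * CliffordAlgebra.ι Qf m) = T m (f x) := by
  have h : ρ (CliffordAlgebra.ι Qf m) = Tl m := by
    rw [ρ, CliffordAlgebra.lift_ι_apply]
  have h2 : ρ (x * CliffordAlgebra.ι Qf m) = ρ x * Tl m := by rw [map_mul, h]
  change (ρ (x * CliffordAlgebra.ι Qf m)).unop e0 = T m ((ρ x).unop e0)
  rw [h2]; rfl

theorem f_mul_η (x : Cl) (i : Fin 4) : f (x * η i) = T (Pi.single i 1) (f x) := f_mul_ι x _

theorem f_one : f 1 = e0 := by simp [f]

theorem f_algebraMap (r : R) : f (algebraMap R Cl r) = r • e0 := by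
  rw [Algebra.algebraMap_eq_smul_one, map_smul, f_one]

theorem η_sq (i : Fin 4) : η i * η i = (Polynomial.X : R) • (1 : Cl) := by
  rw [η, CliffordAlgebra.ι_sq_scalar, Algebra.algebraMap_eq_smul_one, Qf_apply]
  fin_cases i <;> simp

theorem η_anti (i j : Fin 4) (h : i ≠ j) : η i * η j = - (η j * η i) := by
  rw [eq_neg_iff_add_eq_zero, η, η, CliffordAlgebra.ι_mul_ι_add_swap, QuadraticMap.polar]
  simp only [Qf_apply]
  revert h
  fin_cases i <;> fin_cases j <;> simp [mul_add]

def pw (b : Bool) (x : Cl) : Cl := if b then x else 1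
def E (a b c d : Bool) : Cl := pw a (η 0) * pw b (η 1) * pw c (η 2) * pw d (η 3)

theorem pw_comm (b : Bool) (i j : Fin 4) (h : i ≠ j) : pw b (η i) * η j = s b • (η j * pw b (η i)) := by
  cases b
  · simp [pw, s]
  · simp [pw, s, η_anti i j h]

theorem pw_self (b : Bool) (i : Fin 4) : pw b (η i) * η i = th (!b) • pw (!b) (η i) := by
  cases b
  · simp [pw, th]
  · simp [pw, th, η_sq]

theorem E_mul3 (a b c d : Bool) : E a b c d * η 3 = th (!d) • E a b c (!d) := by
  simp only [E, mul_assoc, pw_self, mul_smul_comm]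
theorem E_mul2 (a b c d : Bool) : E a b c d * η 2 = (s d * th (!c)) • E a b (!c) d := by
  simp only [E, mul_assoc]
  rw [pw_comm d 3 2 (by decide)]
  simp only [mul_smul_comm]
  rw [← mul_assoc (pw c (η 2)), pw_self]
  simp only [smul_mul_assoc, mul_smul_comm, smul_smul]
theorem E_mul1 (a b c d : Bool) : E a b c d * η 1 = (s c * s d * th (!b)) • E a (!b) c d := by
  simp only [E, mul_assoc]
  rw [pw_comm d 3 1 (by decide)]
  simp only [mul_smul_comm]
  rw [← mul_assoc (pw c (η 2)), pw_comm c 2 1 (by decide)]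
  simp only [smul_mul_assoc, mul_smul_comm, smul_smul, mul_assoc]
  rw [← mul_assoc (pw b (η 1)), pw_self]
  simp only [smul_mul_assoc, mul_smul_comm, smul_smul, mul_assoc]
  congr 1; ring
theorem E_mul0 (a b c d : Bool) : E a b c d * η 0 = (s b * s c * s d * th (!a)) • E (!a) b c d := by
  simp only [E, mul_assoc]
  rw [pw_comm d 3 0 (by decide)]
  simp only [mul_smul_comm]
  rw [← mul_assoc (pw c (η 2)), pw_comm c 2 0 (by decide)]
  simp only [smul_mul_assoc, mul_smul_comm, smul_smul, mul_assoc]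
  rw [← mul_assoc (pw b (η 1)), pw_comm b 1 0 (by decide)]
  simp only [smul_mul_assoc, mul_smul_comm, smul_smul, mul_assoc]
  rw [← mul_assoc (pw a (η 0)), pw_self]
  simp only [smul_mul_assoc, mul_smul_comm, smul_smul, mul_assoc]
  congr 1; ring

theorem ι_eq (m : Fin 4 → R) :
    CliffordAlgebra.ι Qf m = m 0 • η 0 + m 1 • η 1 + m 2 • η 2 + m 3 • η 3 := by
  simp only [η, ← map_smul, ← map_add]
  congr 1
  funext i
  fin_cases i <;> simp

def g (v : V) : Cl := ∑ a, ∑ b, ∑ c, ∑ d, v a b c d • E a b c d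

theorem g_T (m : Fin 4 → R) (v : V) : g (T m v) = g v * CliffordAlgebra.ι Qf m := by
  rw [ι_eq]
  simp only [g, Finset.sum_mul, mul_add, smul_mul_assoc, mul_smul_comm, E_mul0, E_mul1, E_mul2, E_mul3]
  simp only [Fintype.sum_bool, T, LinearMap.coe_mk, AddHom.coe_mk, Bool.not_true, Bool.not_false]
  module

theorem g_add (v w : V) : g (v + w) = g v + g w := by
  simp only [g, Pi.add_apply, add_smul, Finset.sum_add_distrib]

theorem g_smul (r : R) (w : V) : g (r • w) = r • g w := by
  simp only [g, Pi.smul_apply, smul_eq_mul, mul_smul, Finset.smul_sum]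

theorem g_e0 : g e0 = 1 := by
  simp [g, e0, E, pw]

theorem g_f (x : Cl) : g (f x) = x := by
  induction x using CliffordAlgebra.right_induction with
  | algebraMap r => rw [f_algebraMap, g_smul, g_e0, Algebra.algebraMap_eq_smul_one]
  | add x y hx hy => rw [map_add, g_add, hx, hy]
  | mul_ι m x hx => rw [f_mul_ι, g_T, hx]

theorem torsion (x : Cl) (h : (Polynomial.X : R) • x = 0) : x = 0 := by
  rw [← g_f x]
  have h2 : f x = 0 := by
    have := congrArg f h
    rw [map_smul, map_zero] at this
    exact (smul_eq_zero.mp this).resolve_left Polynomial.X_ne_zero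
  rw [h2]; simp [g]

theorem cancelX (x y : Cl) (h : (Polynomial.X : R) • x = (Polynomial.X : R) • y) : x = y := by
  rw [← sub_eq_zero]; apply torsion; rw [smul_sub, h, sub_self]

def vol : Cl := η 0 * η 1 * η 2 * η 3

theorem f_vol : f vol true true true true = 1 := by
  have h : f (η 0) = T (Pi.single 0 1) e0 := by
    have := f_mul_η 1 0
    rwa [one_mul, f_one] at this
  simp [vol, f_mul_η, h, T, s, th, e0]

theorem key (x : Cl) (h : ∀ i, ∃ y : Cl, x * η i = (Polynomial.X : R) • y)
    (h1 : (f x true true true true).coeff 0 = 0) : ∃ y : Cl, x = (Polynomial.X : R) • y := by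
  have H : ∀ a b c d, ∃ p : R, f x a b c d = Polynomial.X * p := by
    have H0 : ∀ i a b c d, ∃ p : R, T (Pi.single i 1) (f x) a b c d = Polynomial.X * p := by
      intro i a b c d
      obtain ⟨y, hy⟩ := h i
      refine ⟨f y a b c d, ?_⟩
      rw [← f_mul_η, hy, map_smul]; rfl
    have hs : ∀ (b : Bool) (q : R), (∃ p : R, s b * q = Polynomial.X * p) → ∃ p : R, q = Polynomial.X * p := by
      rintro b q ⟨p, hp⟩
      refine ⟨s b * p, ?_⟩
      have : s b * s b = 1 := by cases b <;> simp [s]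
      linear_combination (-q) * this + s b * hp
    intro a b c d
    cases a with
    | false =>
      have := H0 0 true b c d
      simp [T, th, mul_assoc] at this
      exact hs _ _ (hs _ _ (hs _ _ this))
    | true =>
    cases b with
    | false =>
      have := H0 1 true true c d
      simp [T, th, mul_assoc] at this
      exact hs _ _ (hs _ _ this)
    | true =>
    cases c with
    | false =>
      have := H0 2 true true true d
      simp [T, th, mul_assoc] at this
      exact hs _ _ this
    | true =>
    cases d with
    | false =>
      have := H0 3 true true true true
      simp [T, th, mul_assoc] at this
      exact this
    | true =>
      exact Polynomial.X_dvd_iff.mpr h1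
  choose p hp using H
  refine ⟨g p, ?_⟩
  rw [← g_smul, ← g_f x]
  congr 1
  funext a b c d
  exact hp a b c d

end HM
namespace HM

theorem Csmul (r : ℂ) (x : Cl) : r • x = (Polynomial.C r : R) • x := by
  rw [← Polynomial.algebraMap_eq, algebraMap_smul]

theorem ii_mul (x : Cl) : ii * x = (Polynomial.C Complex.I : R) • x := by
  rw [ii, ← Csmul, Algebra.smul_def]

theorem CI : (Polynomial.C Complex.I : R) * Polynomial.C Complex.I = -1 := by
  rw [← Polynomial.C_mul, Complex.I_mul_I]; simp

theorem w11_eq : w11 = CliffordAlgebra.ι Qf ![Polynomial.C Complex.I, 1, 0, 0] := by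
  rw [ι_eq, w11, ii_mul]; simp [add_comm]
theorem w22_eq : w22 = CliffordAlgebra.ι Qf ![-Polynomial.C Complex.I, 1, 0, 0] := by
  rw [ι_eq, w22, ii_mul]; simp; abel
theorem w12_eq : w12 = CliffordAlgebra.ι Qf ![0, 0, Polynomial.C Complex.I, -1] := by
  rw [ι_eq, w12, ii_mul]; simp; abel
theorem w21_eq : w21 = CliffordAlgebra.ι Qf ![0, 0, Polynomial.C Complex.I, 1] := by
  rw [ι_eq, w21, ii_mul]; simp; abel

theorem ι_anti (m n : Fin 4 → R) :
    CliffordAlgebra.ι Qf m * CliffordAlgebra.ι Qf n + CliffordAlgebra.ι Qf n * CliffordAlgebra.ι Qf m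
      = (2 * Polynomial.X * (m 0 * n 0 + m 1 * n 1 + m 2 * n 2 + m 3 * n 3) : R) • (1 : Cl) := by
  rw [CliffordAlgebra.ι_mul_ι_add_swap, QuadraticMap.polar, Algebra.algebraMap_eq_smul_one]
  simp only [Qf_apply, Pi.add_apply]
  congr 1; ring

theorem ι_sq0 (m : Fin 4 → R) (h : m 0 * m 0 + m 1 * m 1 + m 2 * m 2 + m 3 * m 3 = 0) :
    CliffordAlgebra.ι Qf m * CliffordAlgebra.ι Qf m = 0 := by
  rw [CliffordAlgebra.ι_sq_scalar, Qf_apply, h]; simp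

theorem sq11 : w11 * w11 = 0 := by rw [w11_eq]; apply ι_sq0; simp [CI]
theorem sq22 : w22 * w22 = 0 := by rw [w22_eq]; apply ι_sq0; simp [CI]
theorem sq12 : w12 * w12 = 0 := by rw [w12_eq]; apply ι_sq0; simp [CI]
theorem sq21 : w21 * w21 = 0 := by rw [w21_eq]; apply ι_sq0; simp [CI]
theorem an1122 : w11 * w22 + w22 * w11 = (Polynomial.X : R) • (4 : Cl) := by
  rw [w11_eq, w22_eq, ι_anti]; simp [CI]
  rw [show (4 : Cl) = (4 : R) • (1 : Cl) by rw [← Algebra.algebraMap_eq_smul_one]; exact (map_ofNat (algebraMap R Cl) 4).symm, smul_smul]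
  congr 1; ring
theorem an1221 : w12 * w21 + w21 * w12 = -((Polynomial.X : R) • (4 : Cl)) := by
  rw [w12_eq, w21_eq, ι_anti]; simp [CI]
  rw [show (4 : Cl) = (4 : R) • (1 : Cl) by rw [← Algebra.algebraMap_eq_smul_one]; exact (map_ofNat (algebraMap R Cl) 4).symm, smul_smul, ← neg_smul]
  congr 1; ring
theorem an1112 : w11 * w12 + w12 * w11 = 0 := by rw [w11_eq, w12_eq, ι_anti]; simp
theorem an1121 : w11 * w21 + w21 * w11 = 0 := by rw [w11_eq, w21_eq, ι_anti]; simp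
theorem an2212 : w22 * w12 + w12 * w22 = 0 := by rw [w22_eq, w12_eq, ι_anti]; simp
theorem an2221 : w22 * w21 + w21 * w22 = 0 := by rw [w22_eq, w21_eq, ι_anti]; simp

def ex (a b c d : ℕ) : Fin 4 →₀ ℕ := Finsupp.equivFunOnFinite.symm ![a, b, c, d]
def mon (a b c d : ℕ) : P4 := MvPolynomial.monomial (ex a b c d) 1

theorem ex_inj {a b c d a' b' c' d' : ℕ} :
    ex a b c d = ex a' b' c' d' ↔ a = a' ∧ b = b' ∧ c = c' ∧ d = d' := by
  rw [ex, ex, Equiv.apply_eq_iff_eq]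
  constructor
  · intro h
    exact ⟨congrFun h 0, congrFun h 1, congrFun h 2, congrFun h 3⟩
  · rintro ⟨rfl, rfl, rfl, rfl⟩; rfl

theorem mon_mul (a b c d a' b' c' d' : ℕ) :
    mon a b c d * mon a' b' c' d' = mon (a + a') (b + b') (c + c') (d + d') := by
  rw [mon, mon, MvPolynomial.monomial_mul, mon, one_mul]
  congr 2
  ext i
  fin_cases i <;> simp [ex]

theorem X0 : (MvPolynomial.X 0 : P4) = mon 1 0 0 0 := by
  rw [MvPolynomial.X, mon]; congr 2; ext i; fin_cases i <;> simp [ex]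
theorem X1 : (MvPolynomial.X 1 : P4) = mon 0 1 0 0 := by
  rw [MvPolynomial.X, mon]; congr 2; ext i; fin_cases i <;> simp [ex]
theorem X2 : (MvPolynomial.X 2 : P4) = mon 0 0 1 0 := by
  rw [MvPolynomial.X, mon]; congr 2; ext i; fin_cases i <;> simp [ex]
theorem X3 : (MvPolynomial.X 3 : P4) = mon 0 0 0 1 := by
  rw [MvPolynomial.X, mon]; congr 2; ext i; fin_cases i <;> simp [ex]

def co (a b c d : ℕ) : MCl →ₗ[ℂ] Cl :=
  (TensorProduct.rid ℂ Cl).toLinearMap ∘ₗ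
    LinearMap.lTensor Cl (MvPolynomial.lcoeff ℂ (ex a b c d))

theorem co_mon (a b c d a' b' c' d' : ℕ) (x : Cl) :
    co a b c d (x ⊗ₜ mon a' b' c' d') = if a' = a ∧ b' = b ∧ c' = c ∧ d' = d then x else 0 := by
  have : co a b c d (x ⊗ₜ mon a' b' c' d')
      = MvPolynomial.coeff (ex a b c d) (mon a' b' c' d') • x := by
    simp [co]
  rw [this, mon, MvPolynomial.coeff_monomial]
  simp only [ex_inj]
  split_ifs <;> simp

def L (x11 x21 x12 x22 : Cl) : MCl :=
  x11 ⊗ₜ mon 1 0 1 0 + x21 ⊗ₜ mon 0 1 1 0 + x12 ⊗ₜ mon 1 0 0 1 + x22 ⊗ₜ mon 0 1 0 1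

theorem nabla_mon (x : Cl) (a b c d : ℕ) : nablaC (x ⊗ₜ mon a b c d) =
    (x * w11) ⊗ₜ mon (1 + a) b (1 + c) d + (x * w21) ⊗ₜ mon a (1 + b) (1 + c) d
    + (x * w12) ⊗ₜ mon (1 + a) b c (1 + d) + (x * w22) ⊗ₜ mon a (1 + b) c (1 + d) := by
  simp [nablaC, X0, X1, X2, X3, mon_mul]

theorem nabla_one (x : Cl) : nablaC (x ⊗ₜ mon 0 0 0 0) = L (x * w11) (x * w21) (x * w12) (x * w22) := by
  rw [nabla_mon, L]

theorem L_add (a b c d a' b' c' d' : Cl) :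
    L a b c d + L a' b' c' d' = L (a + a') (b + b') (c + c') (d + d') := by
  simp only [L, TensorProduct.add_tmul]; abel

theorem L_smul (r : ℂ) (a b c d : Cl) : r • L a b c d = L (r • a) (r • b) (r • c) (r • d) := by
  simp only [L, smul_add, TensorProduct.smul_tmul']

theorem nabla_L_zero_iff (a b c d : Cl) : nablaC (L a b c d) = 0 ↔
    (a * w11 = 0 ∧ b * w21 = 0 ∧ c * w12 = 0 ∧ d * w22 = 0 ∧
     a * w21 + b * w11 = 0 ∧ a * w12 + c * w11 = 0 ∧ b * w22 + d * w21 = 0 ∧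
     c * w22 + d * w12 = 0 ∧ a * w22 + d * w11 + b * w12 + c * w21 = 0) := by
  have h : nablaC (L a b c d) =
      (a * w11) ⊗ₜ mon 2 0 2 0 + (b * w21) ⊗ₜ mon 0 2 2 0 + (c * w12) ⊗ₜ mon 2 0 0 2
      + (d * w22) ⊗ₜ mon 0 2 0 2 + (a * w21 + b * w11) ⊗ₜ mon 1 1 2 0
      + (a * w12 + c * w11) ⊗ₜ mon 2 0 1 1 + (b * w22 + d * w21) ⊗ₜ mon 0 2 1 1
      + (c * w22 + d * w12) ⊗ₜ mon 1 1 0 2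
      + (a * w22 + d * w11 + b * w12 + c * w21) ⊗ₜ mon 1 1 1 1 := by
    rw [L]
    simp only [map_add, nabla_mon, TensorProduct.add_tmul]
    norm_num
    abel
  rw [h]
  constructor
  · intro h
    have k := fun p q r s => congrArg (co p q r s) h
    simp only [map_add, co_mon, map_zero] at k
    refine ⟨?_, ?_, ?_, ?_, ?_, ?_, ?_, ?_, ?_⟩
    · simpa using k 2 0 2 0
    · simpa using k 0 2 2 0
    · simpa using k 2 0 0 2
    · simpa using k 0 2 0 2
    · simpa using k 1 1 2 0
    · simpa using k 2 0 1 1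
    · simpa using k 0 2 1 1
    · simpa using k 1 1 0 2
    · simpa using k 1 1 1 1
  · rintro ⟨h1, h2, h3, h4, h5, h6, h7, h8, h9⟩
    simp only [h1, h2, h3, h4, h5, h6, h7, h8, h9, TensorProduct.zero_tmul, add_zero]

theorem mon_homu (a b c d : ℕ) : MvPolynomial.IsWeightedHomogeneous wu (mon a b c d) (a + b) := by
  apply MvPolynomial.isWeightedHomogeneous_monomial
  simp [Finsupp.weight_apply, Finsupp.sum_fintype, Fin.sum_univ_four, wu, ex]
theorem mon_homv (a b c d : ℕ) : MvPolynomial.IsWeightedHomogeneous wv (mon a b c d) (c + d) := by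
  apply MvPolynomial.isWeightedHomogeneous_monomial
  simp [Finsupp.weight_apply, Finsupp.sum_fintype, Fin.sum_univ_four, wv, ex]

theorem mon_mem (x : Cl) (a b c d : ℕ) : x ⊗ₜ mon a b c d ∈ MC (a + b) (c + d) :=
  Submodule.subset_span ⟨x, _, mon_homu a b c d, mon_homv a b c d, rfl⟩

theorem L_mem (a b c d : Cl) : L a b c d ∈ MC 1 1 :=
  add_mem (add_mem (add_mem (mon_mem a 1 0 1 0) (mon_mem b 0 1 1 0)) (mon_mem c 1 0 0 1))
    (mon_mem d 0 1 0 1)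

/-- membership in `MC i j` is tested on monomials -/
theorem MC_le (i j : ℕ) (N : Submodule ℂ MCl)
    (h : ∀ x : Cl, ∀ a b c d : ℕ, a + b = i → c + d = j → x ⊗ₜ mon a b c d ∈ N) : MC i j ≤ N := by
  rw [MC, Submodule.span_le]
  rintro _ ⟨x, q, hu, hv, rfl⟩
  change x ⊗ₜ q ∈ N
  rw [q.as_sum, TensorProduct.tmul_sum]
  refine Submodule.sum_mem _ fun m hm => ?_
  have hm' : MvPolynomial.coeff m q ≠ 0 := MvPolynomial.mem_support_iff.mp hm
  have e : m = ex (m 0) (m 1) (m 2) (m 3) := by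
    ext i; fin_cases i <;> simp [ex]
  have hu' := hu hm'
  have hv' := hv hm'
  simp [Finsupp.weight_apply, Finsupp.sum_fintype, Fin.sum_univ_four, wu] at hu'
  simp [Finsupp.weight_apply, Finsupp.sum_fintype, Fin.sum_univ_four, wv] at hv'
  have e2 : MvPolynomial.monomial m (MvPolynomial.coeff m q)
      = MvPolynomial.coeff m q • mon (m 0) (m 1) (m 2) (m 3) := by
    rw [mon, ← e, MvPolynomial.smul_monomial]; simp
  rw [e2, TensorProduct.tmul_smul]
  exact N.smul_mem _ (h _ _ _ _ _ hu' hv')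

theorem MC00 (z : MCl) (hz : z ∈ MC 0 0) : ∃ x : Cl, z = x ⊗ₜ mon 0 0 0 0 := by
  have : MC 0 0 ≤ LinearMap.range ((TensorProduct.mk ℂ Cl P4).flip (mon 0 0 0 0)) := by
    apply MC_le
    intro x a b c d h1 h2
    obtain ⟨rfl, rfl⟩ : a = 0 ∧ b = 0 := by omega
    obtain ⟨rfl, rfl⟩ : c = 0 ∧ d = 0 := by omega
    exact ⟨x, rfl⟩
  obtain ⟨x, hx⟩ := this hz
  exact ⟨x, hx.symm⟩

def N11 : Submodule ℂ MCl where
  carrier := {z | ∃ a b c d, z = L a b c d}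
  add_mem' := by
    rintro _ _ ⟨a, b, c, d, rfl⟩ ⟨a', b', c', d', rfl⟩
    exact ⟨_, _, _, _, L_add _ _ _ _ _ _ _ _⟩
  zero_mem' := ⟨0, 0, 0, 0, by simp [L]⟩
  smul_mem' := by
    rintro r _ ⟨a, b, c, d, rfl⟩
    exact ⟨_, _, _, _, L_smul _ _ _ _ _⟩

theorem MC11 (z : MCl) (hz : z ∈ MC 1 1) : ∃ a b c d, z = L a b c d := by
  have : MC 1 1 ≤ N11 := by
    apply MC_le
    intro x a b c d h1 h2
    have h1' : (a = 1 ∧ b = 0) ∨ (a = 0 ∧ b = 1) := by omega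
    have h2' : (c = 1 ∧ d = 0) ∨ (c = 0 ∧ d = 1) := by omega
    rcases h1' with ⟨rfl, rfl⟩ | ⟨rfl, rfl⟩ <;> rcases h2' with ⟨rfl, rfl⟩ | ⟨rfl, rfl⟩
    · exact ⟨x, 0, 0, 0, by simp [L]⟩
    · exact ⟨0, 0, x, 0, by simp [L]⟩
    · exact ⟨0, x, 0, 0, by simp [L]⟩
    · exact ⟨0, 0, 0, x, by simp [L]⟩
  exact this hz

theorem co_L1 (a b c d : Cl) : co 1 0 1 0 (L a b c d) = a := by
  simp [L, co_mon]
theorem co_L2 (a b c d : Cl) : co 0 1 1 0 (L a b c d) = b := by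
  simp [L, co_mon]
theorem co_L3 (a b c d : Cl) : co 1 0 0 1 (L a b c d) = c := by
  simp [L, co_mon]
theorem co_L4 (a b c d : Cl) : co 0 1 0 1 (L a b c d) = d := by
  simp [L, co_mon]

def top : Cl →ₗ[ℂ] ℂ where
  toFun x := (f x true true true true).coeff 0
  map_add' x y := by simp
  map_smul' r x := by simp [Csmul]

theorem top_X (x : Cl) : top ((Polynomial.X : R) • x) = 0 := by simp [top]
theorem top_vol : top vol = 1 := by simp [top, f_vol]

def φ : MCl →ₗ[ℂ] ℂ :=
  top ∘ₗ (LinearMap.mulRight ℂ w22 ∘ₗ co 1 0 1 0 + LinearMap.mulRight ℂ w11 ∘ₗ co 0 1 0 1)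

theorem φ_L (a b c d : Cl) : φ (L a b c d) = top (a * w22 + d * w11) := by
  simp [φ, co_L1, co_L4]

theorem mul_four (y : Cl) : y * 4 = (4 : ℂ) • y := by
  rw [Algebra.smul_def, Algebra.commutes]
  exact congrArg (y * ·) (map_ofNat (algebraMap ℂ Cl) 4).symm

theorem dη (D a b c d : Cl) (h11 : D * w11 = (Polynomial.X : R) • a)
    (h21 : D * w21 = (Polynomial.X : R) • b) (h12 : D * w12 = (Polynomial.X : R) • c)
    (h22 : D * w22 = (Polynomial.X : R) • d) (i : Fin 4) :
    ∃ y : Cl, D * η i = (Polynomial.X : R) • y := by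
  have hh : (Polynomial.C (1/2 : ℂ) : R) * 2 = 1 := by
    rw [show (2 : R) = Polynomial.C (2 : ℂ) from (map_ofNat Polynomial.C 2).symm, ← Polynomial.C_mul]; norm_num
  have k1 : η 1 = (Polynomial.C (1/2 : ℂ) : R) • (w11 + w22) := by
    simp only [w11, w22, ii_mul]
    match_scalars <;> first | ring1 | linear_combination -hh
  have k0 : η 0 = (-Polynomial.C Complex.I * Polynomial.C (1/2 : ℂ) : R) • (w11 - w22) := by
    simp only [w11, w22, ii_mul]
    match_scalars <;> first | ring1 | linear_combination -hh + Polynomial.C (1/2 : ℂ) * 2 * CI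
  have k3 : η 3 = (Polynomial.C (1/2 : ℂ) : R) • (w21 - w12) := by
    simp only [w21, w12, ii_mul]
    match_scalars <;> first | ring1 | linear_combination -hh
  have k2 : η 2 = (-Polynomial.C Complex.I * Polynomial.C (1/2 : ℂ) : R) • (w21 + w12) := by
    simp only [w21, w12, ii_mul]
    match_scalars <;> first | ring1 | linear_combination -hh + Polynomial.C (1/2 : ℂ) * 2 * CI
  fin_cases i
  · refine ⟨(-Polynomial.C Complex.I * Polynomial.C (1/2 : ℂ) : R) • (a - d), ?_⟩
    change D * η 0 = _
    rw [k0, mul_smul_comm, mul_sub, h11, h22]; module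
  · refine ⟨(Polynomial.C (1/2 : ℂ) : R) • (a + d), ?_⟩
    change D * η 1 = _
    rw [k1, mul_smul_comm, mul_add, h11, h22]; module
  · refine ⟨(-Polynomial.C Complex.I * Polynomial.C (1/2 : ℂ) : R) • (b + c), ?_⟩
    change D * η 2 = _
    rw [k2, mul_smul_comm, mul_add, h21, h12]; module
  · refine ⟨(Polynomial.C (1/2 : ℂ) : R) • (b - c), ?_⟩
    change D * η 3 = _
    rw [k3, mul_smul_comm, mul_sub, h21, h12]; module

theorem ker_sub (a b c d : Cl) (hk : nablaC (L a b c d) = 0) (h0 : top (a * w22 + d * w11) = 0) :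
    ∃ y : Cl, L a b c d = nablaC (y ⊗ₜ mon 0 0 0 0) := by
  rw [nabla_L_zero_iff] at hk
  obtain ⟨h1, h2, h3, h4, h5, h6, h7, h8, h9⟩ := hk
  set D := a * w22 + d * w11 with hD
  have e11 : D * w11 = (Polynomial.X : R) • (a * 4) := by
    have : D * w11 = a * (w11 * w22 + w22 * w11) - (a * w11) * w22 + d * (w11 * w11) := by
      rw [hD]; noncomm_ring
    rw [this, h1, sq11, an1122]; simp
  have e22 : D * w22 = (Polynomial.X : R) • (d * 4) := by
    have : D * w22 = d * (w11 * w22 + w22 * w11) - (d * w22) * w11 + a * (w22 * w22) := by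
      rw [hD]; noncomm_ring
    rw [this, h4, sq22, an1122]; simp
  have e12 : D * w12 = (Polynomial.X : R) • (c * 4) := by
    have : D * w12 = a * (w22 * w12 + w12 * w22) + d * (w11 * w12 + w12 * w11)
        - (a * w12 + c * w11) * w22 - (c * w22 + d * w12) * w11
        + c * (w11 * w22 + w22 * w11) := by
      rw [hD]; noncomm_ring
    rw [this, h6, h8, an2212, an1112, an1122]; simp
  have e21 : D * w21 = (Polynomial.X : R) • (b * 4) := by
    have : D * w21 = a * (w22 * w21 + w21 * w22) + d * (w11 * w21 + w21 * w11)
        - (a * w21 + b * w11) * w22 - (b * w22 + d * w21) * w11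
        + b * (w11 * w22 + w22 * w11) := by
      rw [hD]; noncomm_ring
    rw [this, h5, h7, an2221, an1121, an1122]; simp
  obtain ⟨y, hy⟩ := key D (dη D _ _ _ _ e11 e21 e12 e22) h0
  have q : ∀ (w x : Cl), D * w = (Polynomial.X : R) • (x * 4) → x = ((1/4 : ℂ) • y) * w := by
    intro w x h
    rw [hy, smul_mul_assoc] at h
    have h' := cancelX _ _ h
    rw [smul_mul_assoc, h']
    rw [mul_four, smul_smul]; norm_num
  refine ⟨(1/4 : ℂ) • y, ?_⟩
  rw [nabla_one, ← q _ _ e11, ← q _ _ e21, ← q _ _ e12, ← q _ _ e22]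

theorem nabla_sq (y : Cl) : nablaC (nablaC (y ⊗ₜ mon 0 0 0 0)) = 0 := by
  rw [nabla_one, nabla_L_zero_iff]
  simp only [mul_assoc, ← mul_add, sq11, sq22, sq12, sq21, an2221]
  refine ⟨by simp, by simp, by simp, by simp, ?_, ?_, ?_, ?_, ?_⟩
  · rw [an1121]; simp
  · rw [an1112]; simp
  · rw [add_comm, an2221]; simp
  · rw [add_comm, an2212]; simp
  · rw [an1122, add_assoc, add_comm (w21 * w12), an1221]; simp

theorem volη (i : Fin 4) : ∃ y : Cl, vol * η i = (Polynomial.X : R) • y := by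
  have hv : vol = E true true true true := rfl
  rw [hv]
  fin_cases i
  · exact ⟨-E false true true true, by simpa [s, th] using E_mul0 true true true true⟩
  · exact ⟨E true false true true, by simpa [s, th] using E_mul1 true true true true⟩
  · exact ⟨-E true true false true, by simpa [s, th] using E_mul2 true true true true⟩
  · exact ⟨E true true true false, by simpa [s, th] using E_mul3 true true true true⟩

theorem exists_top : ∃ a b c d, nablaC (L a b c d) = 0 ∧ top (a * w22 + d * w11) = 4 := by
  have hι : ∀ m, ∃ y : Cl, vol * CliffordAlgebra.ι Qf m = (Polynomial.X : R) • y := by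
    intro m
    choose y hy using volη
    refine ⟨m 0 • y 0 + m 1 • y 1 + m 2 • y 2 + m 3 • y 3, ?_⟩
    rw [ι_eq]
    simp only [mul_add, mul_smul_comm, hy]
    module
  obtain ⟨a, ha⟩ := hι ![Polynomial.C Complex.I, 1, 0, 0]
  obtain ⟨d, hd⟩ := hι ![-Polynomial.C Complex.I, 1, 0, 0]
  obtain ⟨c, hc⟩ := hι ![0, 0, Polynomial.C Complex.I, -1]
  obtain ⟨b, hb⟩ := hι ![0, 0, Polynomial.C Complex.I, 1]
  rw [← w11_eq] at ha
  rw [← w22_eq] at hd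
  rw [← w12_eq] at hc
  rw [← w21_eq] at hb
  have h := nabla_sq vol
  rw [nabla_one, nabla_L_zero_iff, ha, hb, hc, hd] at h
  simp only [smul_mul_assoc, ← smul_add] at h
  obtain ⟨h1, h2, h3, h4, h5, h6, h7, h8, h9⟩ := h
  refine ⟨a, b, c, d, ?_, ?_⟩
  · rw [nabla_L_zero_iff]
    exact ⟨torsion _ h1, torsion _ h2, torsion _ h3, torsion _ h4, torsion _ h5, torsion _ h6,
      torsion _ h7, torsion _ h8, torsion _ h9⟩
  · have : a * w22 + d * w11 = (4 : ℂ) • vol := by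
      apply cancelX
      rw [smul_add, ← smul_mul_assoc, ← smul_mul_assoc, ← ha, ← hd, mul_assoc, mul_assoc, ← mul_add,
        an1122, mul_smul_comm]
      congr 1
      exact mul_four vol
    rw [this, map_smul, top_vol]; simp

theorem inj (y : Cl) (h : nablaC (y ⊗ₜ mon 0 0 0 0) = 0) : y = 0 := by
  rw [nabla_one] at h
  have h1 := congrArg (co 1 0 1 0) h
  have h2 := congrArg (co 0 1 0 1) h
  rw [co_L1, map_zero] at h1
  rw [co_L4, map_zero] at h2
  have : (Polynomial.X : R) • (y * 4) = 0 := by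
    rw [← mul_smul_comm, ← an1122, mul_add, ← mul_assoc, ← mul_assoc, h1, h2]; simp
  have h4 := torsion _ this
  rw [mul_four] at h4
  exact (smul_eq_zero.mp h4).resolve_left (by norm_num)

end HM

/-- the homology of the quadrant-C complex at `M(1,1,3,0)`, namely
`ker(∇ : M_C^{(1,1)} → M_C^{(2,2)}) / ∇(M_C^{(0,0)})`, is a one-dimensional
`ℂ`-vector space (the trivial representation); moreover
`∇ : M_C^{(0,0)} → M_C^{(1,1)}` is injective, so the homology at `M(0,0,2,0)`
vanishes. -/
theorem homology_at_M1130 :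
    Nonempty ((↥(MC 1 1 ⊓ LinearMap.ker nablaC) ⧸
        (Submodule.comap (MC 1 1 ⊓ LinearMap.ker nablaC).subtype
          (Submodule.map nablaC (MC 0 0)))) ≃ₗ[ℂ] ℂ) ∧
    MC 0 0 ⊓ LinearMap.ker nablaC = ⊥ := by
  constructor
  · set K := MC 1 1 ⊓ LinearMap.ker nablaC with hK
    have hker : Submodule.comap K.subtype (Submodule.map nablaC (MC 0 0))
        = LinearMap.ker (HM.φ ∘ₗ K.subtype) := by
      ext ⟨z, hz⟩
      obtain ⟨hz1, hz2⟩ := hz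
      simp only [Submodule.mem_comap, Submodule.subtype_apply, LinearMap.mem_ker,
        LinearMap.comp_apply, Submodule.mem_map]
      constructor
      · rintro ⟨x, hx, rfl⟩
        obtain ⟨y, rfl⟩ := HM.MC00 x hx
        rw [HM.nabla_one, HM.φ_L, mul_assoc, mul_assoc, ← mul_add, HM.an1122, mul_smul_comm,
          HM.top_X]
      · intro h
        obtain ⟨a, b, c, d, rfl⟩ := HM.MC11 z hz1
        rw [HM.φ_L] at h
        obtain ⟨y, hy⟩ := HM.ker_sub a b c d hz2 h
        exact ⟨_, HM.mon_mem y 0 0 0 0, hy.symm⟩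
    have hsurj : Function.Surjective (HM.φ ∘ₗ K.subtype) := by
      intro r
      obtain ⟨a, b, c, d, h1, h2⟩ := HM.exists_top
      refine ⟨(r / 4) • ⟨HM.L a b c d, HM.L_mem a b c d, h1⟩, ?_⟩
      rw [map_smul]
      change (r / 4) • HM.φ (HM.L a b c d) = r
      rw [HM.φ_L, h2, smul_eq_mul]
      field_simp
    rw [hker]
    exact ⟨LinearMap.quotKerEquivOfSurjective _ hsurj⟩
  · rw [eq_bot_iff]
    rintro z ⟨hz1, hz2⟩
    obtain ⟨y, rfl⟩ := HM.MC00 z hz1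
    rw [HM.inj y hz2]
    simp

end
end
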